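/- arXiv:2102.04168 — 7 statements merged into one kernel-verified Lean document; each statement's English description precedes it below -/
import Mathlib

section
/- Let d ≥ 1, let Θ be a measurable space, let p be a probability measure on Θ, and let θ⋆ ∈ Θ. Let η : Θ × ℝ^d → ℝ be such that for every θ ∈ Θ the map a ↦ η(θ, a) is twice continuously differentiable with ‖∇_a η(θ,a)‖₂ ≤ ζ_g and ‖∇²_a η(θ,a)‖_op ≤ ζ_h for all a, and ‖∇²_a η(θ,a₁) − ∇²_a η(θ,a₂)‖_op ≤ ζ₃‖a₁ − a₂‖₂ for all a₁, a₂, where ζ_g, ζ_h, ζ₃ > 0; assume that for each fixed a the maps θ ↦ η(θ,a), θ ↦ ∇_a η(θ,a) and θ ↦ ∇²_a η(θ,a) are measurable. Let 0 < ε ≤ min(1, ζ₃/16). Suppose a_prev ∈ ℝ^d is NOT an (ε, 6·√(ζ₃·ε))-approximate local maximum of a ↦ η(θ⋆, a), i.e. either ‖∇_a η(θ⋆, a_prev)‖₂ > ε or there is a unit vector v with ⟨∇²_a η(θ⋆, a_prev) v, v⟩ > 6·√(ζ₃·ε). Suppose a_new ∈ ℝ^d satisfies ∫ η(θ, a_new)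 dp(θ) ≥ ∫ η(θ, a) dp(θ) for every a ∈ ℝ^d. For θ ∈ Θ define Δ(θ) = √( |η(θ,a_new) − η(θ⋆,a_new)|² + |η(θ,a_prev) − η(θ⋆,a_prev)|² + ‖∇_a η(θ,a_prev) − ∇_a η(θ⋆,a_prev)‖₂² + ‖∇²_a η(θ,a_prev) − ∇²_a η(θ⋆,a_prev)‖_op² ). Then, with C₁ = 2 + ζ_g/ζ_h, one has η(θ⋆, a_new) ≥ η(θ⋆, a_prev) + min( ε²/(4ζ_h), ε^{3/2}/√ζ₃ ) − C₁·∫ Δ(θ) dp(θ). -/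
open MeasureTheory RealInnerProductSpace

/-- The Hessian of `f : ℝ^d → ℝ` at `a`, as a continuous linear map
(the Fréchet derivative of the gradient). -/
noncomputable def hessian {d : ℕ} (f : EuclideanSpace ℝ (Fin d) → ℝ)
    (a : EuclideanSpace ℝ (Fin d)) :
    EuclideanSpace ℝ (Fin d) →L[ℝ] EuclideanSpace ℝ (Fin d) :=
  fderiv ℝ (gradient f) a

/-- A second-order Taylor lower bound: if the second derivative of `φ` is bounded below by an affine
function on the nonnegative half-line, then `φ` is bounded below by the corresponding cubic. -/
theorem cubic_le_of_affine_le_second_deriv {φ φ' φ'' : ℝ → ℝ}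
    (hφ : ∀ s, HasDerivAt φ (φ' s) s) (hφ' : ∀ s, HasDerivAt φ' (φ'' s) s) {A B : ℝ}
    (hle : ∀ s, 0 ≤ s → A - B * s ≤ φ'' s) {t : ℝ} (ht : 0 ≤ t) :
    φ 0 + φ' 0 * t + A * t ^ 2 / 2 - B * t ^ 3 / 6 ≤ φ t := by
  have mono : ∀ ψ ψ' : ℝ → ℝ, (∀ s, HasDerivAt ψ (ψ' s) s) → (∀ s, 0 ≤ s → 0 ≤ ψ' s) →
      ∀ s, 0 ≤ s → ψ 0 ≤ ψ s := by
    intro ψ ψ' hψ hnn s hs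
    refine monotoneOn_of_hasDerivWithinAt_nonneg (convex_Ici 0)
      (fun x _ => (hψ x).continuousAt.continuousWithinAt)
      (fun x _ => (hψ x).hasDerivWithinAt) (fun x hx => hnn x ?_) Set.self_mem_Ici hs hs
    exact interior_subset hx
  have hderiv : ∀ s, 0 ≤ s → φ' 0 + A * s - B * s ^ 2 / 2 ≤ φ' s := by
    intro s hs
    have := mono (fun s => φ' s - (A * s - B * s ^ 2 / 2)) (fun s => φ'' s - (A - B * s))
      (fun s => by
        refine (hφ' s).sub (HasDerivAt.congr_deriv (((hasDerivAt_id s).const_mul A).sub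
          ((((hasDerivAt_id s).pow 2).const_mul B).div_const 2)) ?_)
        norm_num
        ring)
      (fun s hs => sub_nonneg.2 (hle s hs)) s hs
    norm_num at this
    linarith
  have := mono (fun s => φ s - (φ' 0 * s + A * s ^ 2 / 2 - B * s ^ 3 / 6))
    (fun s => φ' s - (φ' 0 + A * s - B * s ^ 2 / 2))
    (fun s => by
      refine (hφ s).sub (HasDerivAt.congr_deriv ((((hasDerivAt_id s).const_mul (φ' 0)).add
        ((((hasDerivAt_id s).pow 2).const_mul A).div_const 2)).sub
        ((((hasDerivAt_id s).pow 3).const_mul B).div_const 6)) ?_)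
      norm_num
      ring)
    (fun s hs => sub_nonneg.2 (hderiv s hs)) t ht
  norm_num at this
  linarith

theorem ContDiff.hasDerivAt_comp_line {d : ℕ} {f : EuclideanSpace ℝ (Fin d) → ℝ}
    (hf : ContDiff ℝ 2 f) (a v : EuclideanSpace ℝ (Fin d)) (s : ℝ) :
    HasDerivAt (fun s : ℝ => f (a + s • v)) ⟪gradient f (a + s • v), v⟫ s := by
  have hline : HasDerivAt (fun s : ℝ => a + s • v) v s := by
    simpa using ((hasDerivAt_id s).smul_const v).const_add a
  have hgrad := ((hf.differentiable (by norm_num)) (a + s • v)).hasGradientAt.hasFDerivAt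
  exact (hgrad.comp_hasDerivAt s hline).congr_deriv (by simp)

theorem ContDiff.hasDerivAt_gradient_comp_line {d : ℕ} {f : EuclideanSpace ℝ (Fin d) → ℝ}
    (hf : ContDiff ℝ 2 f) (a v : EuclideanSpace ℝ (Fin d)) (s : ℝ) :
    HasDerivAt (fun s : ℝ => ⟪gradient f (a + s • v), v⟫) ⟪hessian f (a + s • v) v, v⟫ s := by
  have hline : HasDerivAt (fun s : ℝ => a + s • v) v s := by
    simpa using ((hasDerivAt_id s).smul_const v).const_add a
  have hgrad : Differentiable ℝ (gradient f) := by
    have hfderiv : Differentiable ℝ (fderiv ℝ f) :=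
      (hf.fderiv_right (m := 1) (by norm_num)).differentiable (by norm_num)
    exact (InnerProductSpace.toDual ℝ
      (EuclideanSpace ℝ (Fin d))).symm.toContinuousLinearEquiv.differentiable.comp hfderiv
  have := ((hgrad (a + s • v)).hasFDerivAt.comp_hasDerivAt s hline).inner ℝ (hasDerivAt_const s v)
  simpa [hessian] using this

theorem ContDiff.taylor_lower_bound {d : ℕ} {f : EuclideanSpace ℝ (Fin d) → ℝ}
    (hf : ContDiff ℝ 2 f) (a v : EuclideanSpace ℝ (Fin d)) {A B : ℝ}
    (hle : ∀ s : ℝ, 0 ≤ s → A - B * s ≤ ⟪hessian f (a + s • v) v, v⟫) {t : ℝ} (ht : 0 ≤ t) :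
    f a + ⟪gradient f a, v⟫ * t + A * t ^ 2 / 2 - B * t ^ 3 / 6 ≤ f (a + t • v) := by
  simpa using cubic_le_of_affine_le_second_deriv (hf.hasDerivAt_comp_line a v)
    (hf.hasDerivAt_gradient_comp_line a v) hle ht

theorem abs_inner_apply_self_le {E : Type*} [NormedAddCommGroup E] [InnerProductSpace ℝ E]
    (T : E →L[ℝ] E) (v : E) : |⟪T v, v⟫| ≤ ‖T‖ * ‖v‖ ^ 2 :=
  calc |⟪T v, v⟫| ≤ ‖T v‖ * ‖v‖ := abs_real_inner_le_norm _ _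
    _ ≤ ‖T‖ * ‖v‖ * ‖v‖ := by gcongr; exact T.le_opNorm v
    _ = ‖T‖ * ‖v‖ ^ 2 := by ring

theorem ContDiff.descent_lower_bound {d : ℕ} {f : EuclideanSpace ℝ (Fin d) → ℝ}
    (hf : ContDiff ℝ 2 f) {L : ℝ} (hL : ∀ a, ‖hessian f a‖ ≤ L)
    (a v : EuclideanSpace ℝ (Fin d)) :
    f a + ⟪gradient f a, v⟫ - L * ‖v‖ ^ 2 / 2 ≤ f (a + v) := by
  have := hf.taylor_lower_bound a v (A := -(L * ‖v‖ ^ 2)) (B := 0) (fun s _ => by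
    have h₁ := abs_le.1 (abs_inner_apply_self_le (hessian f (a + s • v)) v)
    have h₂ := mul_le_mul_of_nonneg_right (hL (a + s • v)) (sq_nonneg ‖v‖)
    linarith [h₁.1]) zero_le_one
  rw [one_smul] at this
  linarith

theorem ContDiff.cubic_lower_bound {d : ℕ} {f : EuclideanSpace ℝ (Fin d) → ℝ}
    (hf : ContDiff ℝ 2 f) {M : ℝ}
    (hM : ∀ a₁ a₂, ‖hessian f a₁ - hessian f a₂‖ ≤ M * ‖a₁ - a₂‖)
    (a : EuclideanSpace ℝ (Fin d)) {v : EuclideanSpace ℝ (Fin d)} (hv : ‖v‖ = 1)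
    {t : ℝ} (ht : 0 ≤ t) :
    f a + ⟪gradient f a, v⟫ * t + ⟪hessian f a v, v⟫ * t ^ 2 / 2 - M * t ^ 3 / 6
      ≤ f (a + t • v) := by
  refine hf.taylor_lower_bound a v (fun s hs => ?_) ht
  have h₁ := abs_le.1 (abs_inner_apply_self_le (hessian f (a + s • v) - hessian f a) v)
  have h₂ := hM (a + s • v) a
  rw [add_sub_cancel_left, norm_smul, hv, Real.norm_of_nonneg hs, mul_one] at h₂
  rw [sub_apply, inner_sub_left, hv] at h₁
  linarith [h₁.1]

/-- Gain of a gradient step for `f`, taken along the gradient of a nearby function `f₀`. -/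
theorem ContDiff.gradient_step_gain {d : ℕ} {f f₀ : EuclideanSpace ℝ (Fin d) → ℝ}
    (hf : ContDiff ℝ 2 f) {G L ε : ℝ} (hL₀ : 0 < L) (hε : 0 ≤ ε)
    (hG : ∀ a, ‖gradient f₀ a‖ ≤ G) (hL : ∀ a, ‖hessian f a‖ ≤ L)
    {a : EuclideanSpace ℝ (Fin d)} (ha : ε < ‖gradient f₀ a‖) :
    f a + ε ^ 2 / (4 * L) - G / L * ‖gradient f a - gradient f₀ a‖
      ≤ f (a + L⁻¹ • gradient f₀ a) := by
  have key := hf.descent_lower_bound hL a (L⁻¹ • gradient f₀ a)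
  set g := gradient f₀ a
  have h₁ : -(G * ‖gradient f a - g‖) ≤ ⟪gradient f a, g⟫ - ‖g‖ ^ 2 := by
    have h := (abs_le.1 (abs_real_inner_le_norm (gradient f a - g) g)).1
    rw [inner_sub_left, real_inner_self_eq_norm_sq] at h
    nlinarith [mul_le_mul_of_nonneg_left (hG a) (norm_nonneg (gradient f a - g))]
  have h₂ : ε ^ 2 ≤ ‖g‖ ^ 2 := by gcongr
  rw [real_inner_smul_right, norm_smul, Real.norm_of_nonneg (by positivity)] at key
  have h₃ : L * (L⁻¹ * ‖g‖) ^ 2 / 2 = L⁻¹ * (‖g‖ ^ 2 / 2) := by field_simp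
  have h₄ : ε ^ 2 / (4 * L) - G / L * ‖gradient f a - g‖
      = L⁻¹ * (ε ^ 2 / 4 - G * ‖gradient f a - g‖) := by field_simp
  have h₅ := mul_le_mul_of_nonneg_left
    (show ε ^ 2 / 4 - G * ‖gradient f a - g‖ ≤ ⟪gradient f a, g⟫ - ‖g‖ ^ 2 / 2 by
      nlinarith [sq_nonneg ε]) (inv_pos.2 hL₀).le
  linarith

/-- Gain of a step for `f` along a direction of positive curvature of a nearby function `f₀`. -/
theorem ContDiff.curvature_step_gain {d : ℕ} {f f₀ : EuclideanSpace ℝ (Fin d) → ℝ}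
    (hf : ContDiff ℝ 2 f) {M κ t : ℝ} (ht : 0 ≤ t)
    (hM : ∀ a₁ a₂, ‖hessian f a₁ - hessian f a₂‖ ≤ M * ‖a₁ - a₂‖)
    {a v : EuclideanSpace ℝ (Fin d)} (hv : ‖v‖ = 1)
    (hg : 0 ≤ ⟪gradient f₀ a, v⟫) (hκ : κ ≤ ⟪hessian f₀ a v, v⟫) :
    f a + κ * t ^ 2 / 2 - M * t ^ 3 / 6 - t * ‖gradient f a - gradient f₀ a‖
      - t ^ 2 / 2 * ‖hessian f a - hessian f₀ a‖ ≤ f (a + t • v) := by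
  have key := hf.cubic_lower_bound hM a hv ht
  have h₁ := (abs_le.1 (abs_real_inner_le_norm (gradient f a - gradient f₀ a) v)).1
  have h₂ := (abs_le.1 (abs_inner_apply_self_le (hessian f a - hessian f₀ a) v)).1
  rw [inner_sub_left, hv] at h₁
  rw [sub_apply, inner_sub_left, hv] at h₂
  have h₃ : -‖gradient f a - gradient f₀ a‖ * t ≤ ⟪gradient f a, v⟫ * t := by
    gcongr; linarith
  have h₄ : (κ - ‖hessian f a - hessian f₀ a‖) * (t ^ 2 / 2) ≤ ⟪hessian f a v, v⟫ * (t ^ 2 / 2) := by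
    gcongr; linarith
  linarith

theorem curvature_gain_lower_bound {M ε : ℝ} (hM : 0 < M) (hε : 0 < ε) :
    ε ^ ((3 : ℝ) / 2) / √M
      ≤ 6 * √(M * ε) * √(ε / M) ^ 2 / 2 - M * √(ε / M) ^ 3 / 6 := by
  have hpow : ε ^ ((3 : ℝ) / 2) = √ε ^ 3 := by
    rw [Real.sqrt_eq_rpow, ← Real.rpow_natCast, ← Real.rpow_mul hε.le]
    norm_num
  rw [hpow, Real.sqrt_mul hM.le, Real.sqrt_div hε.le]
  have hx := Real.sqrt_pos.2 hM
  have hM' : M = √M ^ 2 := (Real.sq_sqrt hM.le).symm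
  have : 6 * (√M * √ε) * (√ε / √M) ^ 2 / 2 - M * (√ε / √M) ^ 3 / 6
      = 17 / 6 * (√ε ^ 3 / √M) := by
    nth_rewrite 3 [hM']
    field_simp
    ring
  rw [this]
  have : 0 ≤ √ε ^ 3 / √M := by positivity
  linarith

theorem weighted_sum_le_two_mul_sqrt {w x y z t : ℝ} (ht₀ : 0 ≤ t) (ht : t ≤ 1 / 4) :
    w + x + t * y + t ^ 2 / 2 * z ≤ 2 * √(w ^ 2 + x ^ 2 + y ^ 2 + z ^ 2) := by
  have h : √(4 * (w ^ 2 + x ^ 2 + y ^ 2 + z ^ 2)) = 2 * √(w ^ 2 + x ^ 2 + y ^ 2 + z ^ 2) := by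
    rw [Real.sqrt_mul (by norm_num), show (4 : ℝ) = 2 ^ 2 by norm_num,
      Real.sqrt_sq (by norm_num)]
  rw [← h]
  apply Real.le_sqrt_of_sq_le
  set s := t ^ 2 / 2 with hs
  have ht₂ : t ^ 2 ≤ 1 / 16 := by nlinarith
  have hs₂ : s ^ 2 ≤ 1 := by nlinarith [sq_nonneg t]
  have hcs : (w + x + t * y + s * z) ^ 2
      ≤ (1 + 1 + t ^ 2 + s ^ 2) * (w ^ 2 + x ^ 2 + y ^ 2 + z ^ 2) := by
    nlinarith [sq_nonneg (w - x), sq_nonneg (w * t - y), sq_nonneg (w * s - z),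
      sq_nonneg (x * t - y), sq_nonneg (x * s - z), sq_nonneg (t * z - s * y)]
  refine hcs.trans ?_
  gcongr
  linarith

/-- **Local improvement lemma for the virtual-ascent step (Lemma 3.3 / `lem:bandit-improvement`).**
If `a_prev` is not an `(ε, 6√(ζ₃ε))`-approximate local maximum of `η(θ⋆, ·)` and `a_new`
maximizes the expected virtual reward `∫ η(θ, ·) dp(θ)`, then the real reward improves by
`min(ε²/(4ζ_h), ε^{3/2}/√ζ₃)` up to the model-error term `C₁ ∫ Δ dp`. -/
theorem bandit_improvement
    {d : ℕ} (hd : 1 ≤ d)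
    {Θ : Type*} [MeasurableSpace Θ] (p : Measure Θ) [IsProbabilityMeasure p] (θstar : Θ)
    (η : Θ → EuclideanSpace ℝ (Fin d) → ℝ)
    (ζg ζh ζ3 : ℝ) (hζg : 0 < ζg) (hζh : 0 < ζh) (hζ3 : 0 < ζ3)
    (hC2 : ∀ θ, ContDiff ℝ 2 (η θ))
    (hgradbound : ∀ θ a, ‖gradient (η θ) a‖ ≤ ζg)
    (hhessbound : ∀ θ a, ‖hessian (η θ) a‖ ≤ ζh)
    (hhesslip : ∀ θ a₁ a₂, ‖hessian (η θ) a₁ - hessian (η θ) a₂‖ ≤ ζ3 * ‖a₁ - a₂‖)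
    (hmeas₀ : ∀ a, Measurable fun θ => η θ a)
    (hmeas₁ : ∀ a, Measurable fun θ => gradient (η θ) a)
    (hmeas₂ : ∀ a, Measurable fun θ => hessian (η θ) a)
    (ε : ℝ) (hε0 : 0 < ε) (hε : ε ≤ min 1 (ζ3 / 16))
    (aprev anew : EuclideanSpace ℝ (Fin d))
    -- `a_prev` is NOT an `(ε, 6√(ζ₃ε))`-approximate local maximum of `η(θ⋆, ·)`:
    (hnotloc : ε < ‖gradient (η θstar) aprev‖ ∨
      ∃ v : EuclideanSpace ℝ (Fin d), ‖v‖ = 1 ∧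
        6 * Real.sqrt (ζ3 * ε) < ⟪hessian (η θstar) aprev v, v⟫)
    -- integrability of the virtual rewards and of the error term:
    (hηint : ∀ a, Integrable (fun θ => η θ a) p)
    -- `a_new` maximizes the expected virtual reward:
    (hopt : ∀ a : EuclideanSpace ℝ (Fin d), ∫ θ, η θ a ∂p ≤ ∫ θ, η θ anew ∂p)
    -- the model-error term:
    (Δ : Θ → ℝ)
    (hΔ : ∀ θ, Δ θ = Real.sqrt (|η θ anew - η θstar anew| ^ 2
      + |η θ aprev - η θstar aprev| ^ 2
      + ‖gradient (η θ) aprev - gradient (η θstar) aprev‖ ^ 2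
      + ‖hessian (η θ) aprev - hessian (η θstar) aprev‖ ^ 2))
    (hΔint : Integrable Δ p) :
    η θstar aprev + min (ε ^ 2 / (4 * ζh)) (ε ^ ((3 : ℝ) / 2) / Real.sqrt ζ3)
      - (2 + ζg / ζh) * ∫ θ, Δ θ ∂p ≤ η θstar anew := by
  have hε₃ : ε ≤ ζ3 / 16 := hε.trans (min_le_right _ _)
  have hΔ₀ : ∀ θ, 0 ≤ Δ θ := fun θ => by rw [hΔ]; positivity
  obtain ⟨u, hu⟩ : ∃ u, ∀ θ, η θstar aprev
      + min (ε ^ 2 / (4 * ζh)) (ε ^ ((3 : ℝ) / 2) / Real.sqrt ζ3) - (2 + ζg / ζh) * Δ θ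
        ≤ η θ (aprev + u) + η θstar anew - η θ anew := by
    rcases hnotloc with hgrad | ⟨v, hv, hcurv⟩
    · refine ⟨ζh⁻¹ • gradient (η θstar) aprev, fun θ => ?_⟩
      have key := (hC2 θ).gradient_step_gain hζh hε0.le (hgradbound θstar) (hhessbound θ) hgrad
      have hnew : |η θ anew - η θstar anew| ≤ Δ θ := by
        rw [hΔ]; apply Real.le_sqrt_of_sq_le; nlinarith
      have hprev : |η θ aprev - η θstar aprev| ≤ Δ θ := by
        rw [hΔ]; apply Real.le_sqrt_of_sq_le; nlinarith
      have hgradΔ : ‖gradient (η θ) aprev - gradient (η θstar) aprev‖ ≤ Δ θ := by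
        rw [hΔ]; apply Real.le_sqrt_of_sq_le; nlinarith
      have hmul := mul_le_mul_of_nonneg_left hgradΔ (div_pos hζg hζh).le
      have hmin := min_le_left (ε ^ 2 / (4 * ζh)) (ε ^ ((3 : ℝ) / 2) / Real.sqrt ζ3)
      linarith [(abs_le.1 hnew).2, (abs_le.1 hprev).1]
    · obtain ⟨w, hw, hgw, hcurvw⟩ : ∃ w, ‖w‖ = 1 ∧ 0 ≤ ⟪gradient (η θstar) aprev, w⟫ ∧
          6 * Real.sqrt (ζ3 * ε) ≤ ⟪hessian (η θstar) aprev w, w⟫ := by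
        rcases le_total 0 ⟪gradient (η θstar) aprev, v⟫ with h | h
        · exact ⟨v, hv, h, hcurv.le⟩
        · exact ⟨-v, by simpa using hv, by simpa using h, by simpa using hcurv.le⟩
      refine ⟨Real.sqrt (ε / ζ3) • w, fun θ => ?_⟩
      have ht : Real.sqrt (ε / ζ3) ≤ 1 / 4 := by
        rw [Real.sqrt_le_left (by norm_num), div_le_iff₀ hζ3]
        linarith
      have key := (hC2 θ).curvature_step_gain (Real.sqrt_nonneg (ε / ζ3)) (hhesslip θ) hw hgw hcurvw
      have hsum := weighted_sum_le_two_mul_sqrt (w := |η θ anew - η θstar anew|)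
        (x := |η θ aprev - η θstar aprev|)
        (y := ‖gradient (η θ) aprev - gradient (η θstar) aprev‖)
        (z := ‖hessian (η θ) aprev - hessian (η θstar) aprev‖) (Real.sqrt_nonneg (ε / ζ3)) ht
      rw [← hΔ] at hsum
      have hgain := curvature_gain_lower_bound hζ3 hε0
      have hmul := mul_nonneg (div_pos hζg hζh).le (hΔ₀ θ)
      have hmin := min_le_right (ε ^ 2 / (4 * ζh)) (ε ^ ((3 : ℝ) / 2) / Real.sqrt ζ3)
      linarith [le_abs_self (η θ anew - η θstar anew), neg_abs_le (η θ aprev - η θstar aprev)]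
  have hadd : Integrable (fun θ => η θ (aprev + u) + η θstar anew) p :=
    (hηint (aprev + u)).add (integrable_const _)
  have hint := integral_mono ((integrable_const _).sub (hΔint.const_mul _))
    (hadd.sub (hηint anew)) hu
  rw [integral_sub' (integrable_const _) (hΔint.const_mul _), integral_sub' hadd (hηint anew),
    integral_add (hηint (aprev + u)) (integrable_const _), integral_const_mul] at hint
  simp only [integral_const, probReal_univ, one_smul] at hint
  linarith [hopt (aprev + u)]
end

section
/- Let d ≥ 1, let Θ be a measurable space, and let θ⋆ ∈ Θ. Let η : Θ × ℝ^d → [0,1] be such that for every θ ∈ Θ the map a ↦ η(θ, a) is twice continuously differentiable with ‖∇_a η(θ,a)‖₂ ≤ ζ_g and ‖∇²_a η(θ,a)‖_op ≤ ζ_h for all a, and ‖∇²_a η(θ,a₁) − ∇²_a η(θ,a₂)‖_op ≤ ζ₃‖a₁ − a₂‖₂ for all a₁, a₂, where ζ_g, ζ_h, ζ₃ > 0; assume that for each fixed a the maps θ ↦ η(θ,a), θ ↦ ∇_a η(θ,a) and θ ↦ ∇²_a η(θ,a) are measurable. Let 0 < ε ≤ min(1, ζ₃/16) and assume the set 𝔄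 of (ε, 6·√(ζ₃·ε))-approximate local maxima of a ↦ η(θ⋆, a) is nonempty. Let T ≥ 1, let p₁, …, p_T be probability measures on Θ, and let a₀, a₁, …, a_T ∈ ℝ^d be such that for each t ∈ {1,…,T}, a_t satisfies ∫ η(θ, a_t) dp_t(θ) ≥ ∫ η(θ, a) dp_t(θ) for all a ∈ ℝ^d. For t ∈ {1,…,T} set δ_t = inf_{a ∈ 𝔄} η(θ⋆, a) − η(θ⋆, a_t), and set Δ̄_t = ∫ √( |η(θ,a_t) − η(θ⋆,a_t)|² + |η(θ,a_{t−1}) − η(θ⋆,a_{t−1})|² + ‖∇_a η(θ,a_{t−1}) − ∇_a η(θ⋆,a_{t−1})‖₂² + ‖∇²_a η(θ,a_{t−1}) − ∇²_a η(θ⋆,a_{t−1})‖_op² ) dp_t(θ). Then, with υ = min( ε²/(4ζ_h), ε^{3/2}/√ζ₃ ) and C₁ = 2 + ζ_g/ζ_h, one has ∑_{t=1}^{T} δ_t ≤ (1/υ)·( 1 + C₁ · ∑_{t=2}^{T} Δ̄_t ). -/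
open MeasureTheory RealInnerProductSpace

/-- Second-order Taylor lower bound on `[0, 1]`. -/
theorem taylor_lower_bound_unit_interval {φ φ' φ'' : ℝ → ℝ} {c : ℝ}
    (h₁ : ∀ u, HasDerivAt φ (φ' u) u) (h₂ : ∀ u, HasDerivAt φ' (φ'' u) u)
    (hc : ∀ u ∈ Set.Icc (0 : ℝ) 1, c ≤ φ'' u) :
    φ 0 + φ' 0 + c / 2 ≤ φ 1 := by
  have hψ : ∀ u, HasDerivAt (fun u => φ' u - c * u) (φ'' u - c) u := fun u =>
    ((h₂ u).sub ((hasDerivAt_id u).const_mul c)).congr_deriv (by simp)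
  have hψmono : MonotoneOn (fun u => φ' u - c * u) (Set.Icc 0 1) := by
    refine monotoneOn_of_deriv_nonneg (convex_Icc 0 1)
      (fun u _ => (hψ u).continuousAt.continuousWithinAt)
      (fun u _ => (hψ u).differentiableAt.differentiableWithinAt) fun u hu => ?_
    rw [(hψ u).deriv]
    exact sub_nonneg.2 (hc u (interior_subset hu))
  have hχ : ∀ u, HasDerivAt (fun u => φ u - φ' 0 * u - c / 2 * u ^ 2)
      (φ' u - φ' 0 - c * u) u := fun u => by
    refine (((h₁ u).sub ((hasDerivAt_id u).const_mul (φ' 0))).sub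
      (((hasDerivAt_id u).pow 2).const_mul (c / 2))).congr_deriv ?_
    simp
    ring
  have hχmono : MonotoneOn (fun u => φ u - φ' 0 * u - c / 2 * u ^ 2) (Set.Icc 0 1) := by
    refine monotoneOn_of_deriv_nonneg (convex_Icc 0 1)
      (fun u _ => (hχ u).continuousAt.continuousWithinAt)
      (fun u _ => (hχ u).differentiableAt.differentiableWithinAt) fun u hu => ?_
    have hu' := interior_subset hu
    have := hψmono (Set.left_mem_Icc.2 zero_le_one) hu' hu'.1
    rw [(hχ u).deriv]
    simp only at this
    linarith
  have := hχmono (Set.left_mem_Icc.2 zero_le_one) (Set.right_mem_Icc.2 zero_le_one) zero_le_one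
  simp only at this
  linarith

section Taylor

variable {d : ℕ} {f : EuclideanSpace ℝ (Fin d) → ℝ}

theorem hasFDerivAt_gradient (hf : ContDiff ℝ 2 f) (x : EuclideanSpace ℝ (Fin d)) :
    HasFDerivAt (gradient f) (hessian f x) x := by
  have h : ContDiff ℝ 1 (gradient f) :=
    (InnerProductSpace.toDual ℝ (EuclideanSpace ℝ (Fin d))).symm.contDiff.comp
      (hf.fderiv_right (m := 1) (by norm_num))
  exact (h.differentiable (by norm_num) x).hasFDerivAt

theorem taylor_lower_bound (hf : ContDiff ℝ 2 f) (x s : EuclideanSpace ℝ (Fin d)) {c : ℝ}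
    (hc : ∀ u ∈ Set.Icc (0 : ℝ) 1, c ≤ ⟪hessian f (x + u • s) s, s⟫) :
    f x + ⟪gradient f x, s⟫ + c / 2 ≤ f (x + s) := by
  have hline : ∀ u : ℝ, HasDerivAt (fun u : ℝ => x + u • s) s u := fun u => by
    simpa using ((hasDerivAt_id u).smul_const s).const_add x
  have h₁ : ∀ u : ℝ, HasDerivAt (fun u : ℝ => f (x + u • s))
      ⟪gradient f (x + u • s), s⟫ u := fun u =>
    ((hf.differentiable (by norm_num) (x + u • s)).hasGradientAt.hasFDerivAt.comp_hasDerivAt u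
      (hline u)).congr_deriv (by simp)
  have h₂ : ∀ u : ℝ, HasDerivAt (fun u : ℝ => ⟪gradient f (x + u • s), s⟫)
      ⟪hessian f (x + u • s) s, s⟫ u := fun u => by
    simpa using ((hasFDerivAt_gradient hf (x + u • s)).comp_hasDerivAt u (hline u)).inner ℝ
      (hasDerivAt_const u s)
  simpa using taylor_lower_bound_unit_interval h₁ h₂ hc

theorem abs_inner_apply_self_le_s1 (A : EuclideanSpace ℝ (Fin d) →L[ℝ] EuclideanSpace ℝ (Fin d))
    (s : EuclideanSpace ℝ (Fin d)) : |⟪A s, s⟫| ≤ ‖A‖ * ‖s‖ ^ 2 := by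
  calc |⟪A s, s⟫| ≤ ‖A s‖ * ‖s‖ := abs_real_inner_le_norm _ _
    _ ≤ ‖A‖ * ‖s‖ * ‖s‖ := by gcongr; exact A.le_opNorm s
    _ = ‖A‖ * ‖s‖ ^ 2 := by ring

theorem lower_bound_of_hessian_bounded (hf : ContDiff ℝ 2 f) {L : ℝ}
    (hL : ∀ x, ‖hessian f x‖ ≤ L) (x s : EuclideanSpace ℝ (Fin d)) :
    f x + ⟪gradient f x, s⟫ - L / 2 * ‖s‖ ^ 2 ≤ f (x + s) := by
  have := taylor_lower_bound hf x s (c := -(L * ‖s‖ ^ 2)) fun u _ =>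
    neg_le_of_abs_le ((abs_inner_apply_self_le_s1 _ s).trans (by gcongr; exact hL _))
  linarith

theorem lower_bound_of_hessian_lipschitz (hf : ContDiff ℝ 2 f) {L : ℝ} (hL0 : 0 ≤ L)
    (hL : ∀ x y, ‖hessian f x - hessian f y‖ ≤ L * ‖x - y‖) (x s : EuclideanSpace ℝ (Fin d)) :
    f x + ⟪gradient f x, s⟫ + (⟪hessian f x s, s⟫ - L * ‖s‖ ^ 3) / 2 ≤ f (x + s) := by
  refine taylor_lower_bound hf x s fun u hu => ?_
  have h := neg_le_of_abs_le (abs_inner_apply_self_le_s1 (hessian f (x + u • s) - hessian f x) s)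
  have hus : ‖hessian f (x + u • s) - hessian f x‖ ≤ L * ‖s‖ := by
    refine (hL _ _).trans (mul_le_mul_of_nonneg_left ?_ hL0)
    rw [add_sub_cancel_left, norm_smul, Real.norm_of_nonneg hu.1]
    exact mul_le_of_le_one_left (norm_nonneg s) hu.2
  have := mul_le_mul_of_nonneg_right hus (sq_nonneg ‖s‖)
  rw [sub_apply, inner_sub_left] at h
  linarith

end Taylor

/-- The pointwise discrepancy between a model `f` and the truth `g`: values at `y`, and the
2-jets at `x`. -/
noncomputable def modelError {d : ℕ} (f g : EuclideanSpace ℝ (Fin d) → ℝ)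
    (y x : EuclideanSpace ℝ (Fin d)) : ℝ :=
  Real.sqrt (|f y - g y| ^ 2 + |f x - g x| ^ 2 + ‖gradient f x - gradient g x‖ ^ 2
    + ‖hessian f x - hessian g x‖ ^ 2)

section ModelError

variable {d : ℕ} {f g : EuclideanSpace ℝ (Fin d) → ℝ} {x y : EuclideanSpace ℝ (Fin d)}

theorem modelError_nonneg : 0 ≤ modelError f g y x := Real.sqrt_nonneg _

theorem value_errors_add_gradient_error_le {k : ℝ} (hk : 0 ≤ k) :
    |f y - g y| + |f x - g x| + k * ‖gradient f x - gradient g x‖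
      ≤ (2 + k) * modelError f g y x := by
  have h₁ : |f y - g y| ≤ modelError f g y x := Real.le_sqrt_of_sq_le (by
    nlinarith [sq_nonneg |f x - g x|, sq_nonneg ‖gradient f x - gradient g x‖,
      sq_nonneg ‖hessian f x - hessian g x‖])
  have h₂ : |f x - g x| ≤ modelError f g y x := Real.le_sqrt_of_sq_le (by
    nlinarith [sq_nonneg |f y - g y|, sq_nonneg ‖gradient f x - gradient g x‖,
      sq_nonneg ‖hessian f x - hessian g x‖])
  have h₃ : ‖gradient f x - gradient g x‖ ≤ modelError f g y x := Real.le_sqrt_of_sq_le (by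
    nlinarith [sq_nonneg |f x - g x|, sq_nonneg |f y - g y|,
      sq_nonneg ‖hessian f x - hessian g x‖])
  nlinarith

theorem jet_errors_le {r : ℝ} (hr0 : 0 ≤ r) (hr : r ≤ 1 / 4) :
    |f y - g y| + |f x - g x| + r * ‖gradient f x - gradient g x‖
      + r ^ 2 / 2 * ‖hessian f x - hessian g x‖ ≤ 2 * modelError f g y x := by
  have h₃ : r * ‖gradient f x - gradient g x‖ ≤ 1 / 4 * ‖gradient f x - gradient g x‖ := by
    gcongr
  have h₄ : r ^ 2 / 2 * ‖hessian f x - hessian g x‖ ≤ 1 / 4 * ‖hessian f x - hessian g x‖ := by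
    refine mul_le_mul_of_nonneg_right ?_ (norm_nonneg _)
    nlinarith
  suffices (|f y - g y| + |f x - g x| + 1 / 4 * ‖gradient f x - gradient g x‖
      + 1 / 4 * ‖hessian f x - hessian g x‖) / 2 ≤ modelError f g y x by linarith
  generalize ha : |f y - g y| = a
  generalize hb : |f x - g x| = b
  generalize hc : ‖gradient f x - gradient g x‖ = c
  generalize he : ‖hessian f x - hessian g x‖ = e
  rw [modelError, ha, hb, hc, he]
  refine Real.le_sqrt_of_sq_le ?_
  nlinarith [sq_nonneg (a - b), sq_nonneg (a - c), sq_nonneg (a - e), sq_nonneg (b - c),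
    sq_nonneg (b - e), sq_nonneg (c - e), sq_nonneg a, sq_nonneg b, sq_nonneg c, sq_nonneg e]

/-- The value transfer from the truth `g` to the model `f` along a first-order step. -/
theorem gradient_step_le (hf : ContDiff ℝ 2 f) {G L : ℝ} (hG : 0 ≤ G) (hL0 : 0 < L)
    (hL : ∀ z, ‖hessian f z‖ ≤ L) (hgrad : ‖gradient g x‖ ≤ G) :
    g x + ‖gradient g x‖ ^ 2 / (2 * L) + (f y - g y) - (2 + G / L) * modelError f g y x
      ≤ f (x + (1 / L) • gradient g x) := by
  have h := lower_bound_of_hessian_bounded hf hL x ((1 / L) • gradient g x)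
  have herr := value_errors_add_gradient_error_le (f := f) (g := g) (x := x) (y := y)
    (div_nonneg hG hL0.le)
  have hinner : -(G * ‖gradient f x - gradient g x‖)
      ≤ ⟪gradient f x - gradient g x, gradient g x⟫ := by
    refine neg_le_of_abs_le ((abs_real_inner_le_norm _ _).trans ?_)
    rw [mul_comm]
    gcongr
  rw [inner_sub_left, real_inner_self_eq_norm_sq] at hinner
  rw [inner_smul_right, norm_smul, Real.norm_of_nonneg (by positivity)] at h
  have hy := le_abs_self (f y - g y)
  have hx := neg_abs_le (f x - g x)
  have h' := mul_le_mul_of_nonneg_left hinner (one_div_pos.2 hL0).le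
  have e₁ : L / 2 * (1 / L * ‖gradient g x‖) ^ 2 = 1 / L * ‖gradient g x‖ ^ 2 / 2 := by
    field_simp
  have e₂ : ‖gradient g x‖ ^ 2 / (2 * L) = 1 / L * ‖gradient g x‖ ^ 2 / 2 := by
    field_simp
  have e₃ : G / L * ‖gradient f x - gradient g x‖
      = 1 / L * (G * ‖gradient f x - gradient g x‖) := by
    field_simp
  rw [e₁] at h
  rw [e₃] at herr
  rw [e₂]
  linarith

/-- The value transfer from the truth `g` to the model `f` along a step of length `r` in an
ascent direction. -/
theorem curvature_step_le (hf : ContDiff ℝ 2 f) {M : ℝ} (hM0 : 0 ≤ M)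
    (hM : ∀ z w, ‖hessian f z - hessian f w‖ ≤ M * ‖z - w‖)
    {v : EuclideanSpace ℝ (Fin d)} (hv : ‖v‖ = 1) (hgv : 0 ≤ ⟪gradient g x, v⟫)
    {r : ℝ} (hr0 : 0 ≤ r) (hr : r ≤ 1 / 4) :
    g x + (⟪hessian g x v, v⟫ * r ^ 2 - M * r ^ 3) / 2 + (f y - g y)
      - 2 * modelError f g y x ≤ f (x + r • v) := by
  have h := lower_bound_of_hessian_lipschitz hf hM0 hM x (r • v)
  have herr := jet_errors_le (f := f) (g := g) (x := x) (y := y) hr0 hr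
  have hgrad := neg_le_of_abs_le (abs_real_inner_le_norm (gradient f x - gradient g x) v)
  have hhess := neg_le_of_abs_le (abs_inner_apply_self_le_s1 (hessian f x - hessian g x) v)
  rw [hv, inner_sub_left] at hgrad
  rw [hv, sub_apply, inner_sub_left] at hhess
  rw [map_smul, inner_smul_right, inner_smul_right, inner_smul_left, norm_smul, hv,
    Real.norm_of_nonneg hr0, conj_trivial] at h
  have hy := le_abs_self (f y - g y)
  have hx := neg_abs_le (f x - g x)
  have h₁ := mul_le_mul_of_nonneg_left hgrad hr0
  have h₂ := mul_le_mul_of_nonneg_left hhess (by positivity : 0 ≤ r ^ 2 / 2)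
  have h₃ := mul_nonneg hr0 hgv
  nlinarith

end ModelError

section Expectation

variable {d : ℕ} {Θ : Type*} [MeasurableSpace Θ]
  {η : Θ → EuclideanSpace ℝ (Fin d) → ℝ}

theorem integrable_of_mem_unitInterval (hrange : ∀ θ a, η θ a ∈ Set.Icc (0 : ℝ) 1)
    (hmeas₀ : ∀ a, Measurable fun θ => η θ a) (μ : Measure Θ) [IsProbabilityMeasure μ]
    (a : EuclideanSpace ℝ (Fin d)) : Integrable (fun θ => η θ a) μ :=
  Integrable.of_mem_Icc 0 1 (hmeas₀ a).aemeasurable (.of_forall fun θ => hrange θ a)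

theorem integrable_modelError (hrange : ∀ θ a, η θ a ∈ Set.Icc (0 : ℝ) 1) {G L : ℝ}
    (hgrad : ∀ θ a, ‖gradient (η θ) a‖ ≤ G) (hhess : ∀ θ a, ‖hessian (η θ) a‖ ≤ L)
    (hmeas₀ : ∀ a, Measurable fun θ => η θ a)
    (hmeas₁ : ∀ a, Measurable fun θ => gradient (η θ) a)
    (hmeas₂ : ∀ a, Measurable fun θ => hessian (η θ) a)
    (θstar : Θ) (μ : Measure Θ) [IsProbabilityMeasure μ] (y x : EuclideanSpace ℝ (Fin d)) :
    Integrable (fun θ => modelError (η θ) (η θstar) y x) μ := by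
  have habs : ∀ θ a, |η θ a - η θstar a| ≤ 1 := fun θ a => by
    have h₁ := hrange θ a
    have h₂ := hrange θstar a
    rw [abs_le]
    constructor <;> linarith [h₁.1, h₁.2, h₂.1, h₂.2]
  have hm₁ : Measurable fun θ => ‖gradient (η θ) x - gradient (η θstar) x‖ :=
    ((continuous_id.sub continuous_const).norm.measurable).comp (hmeas₁ x)
  have hm₂ : Measurable fun θ => ‖hessian (η θ) x - hessian (η θstar) x‖ :=
    ((continuous_id.sub continuous_const).norm.measurable).comp (hmeas₂ x)
  have hm₀ : ∀ a, Measurable fun θ => |η θ a - η θstar a| := fun a =>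
    ((continuous_id.sub continuous_const).abs.measurable).comp (hmeas₀ a)
  refine Integrable.of_mem_Icc 0 (Real.sqrt (1 ^ 2 + 1 ^ 2 + (G + G) ^ 2 + (L + L) ^ 2)) ?_
    (.of_forall fun θ => ⟨modelError_nonneg, Real.sqrt_le_sqrt ?_⟩)
  · exact (((((hm₀ y).pow_const 2).add ((hm₀ x).pow_const 2)).add (hm₁.pow_const 2)).add
      (hm₂.pow_const 2)).sqrt.aemeasurable
  · have h₁ := habs θ y
    have h₂ := habs θ x
    have h₃ := (norm_sub_le (gradient (η θ) x) (gradient (η θstar) x)).trans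
      (add_le_add (hgrad θ x) (hgrad θstar x))
    have h₄ := (norm_sub_le (hessian (η θ) x) (hessian (η θstar) x)).trans
      (add_le_add (hhess θ x) (hhess θstar x))
    gcongr

/-- A pointwise lower bound for the model at a comparison point turns into a lower bound for the
true value at a maximizer of the expected model. -/
theorem le_value_at_maximizer {μ : Measure Θ} [IsProbabilityMeasure μ]
    {a a' : EuclideanSpace ℝ (Fin d)} {D : Θ → ℝ} {b c C : ℝ}
    (hη : ∀ a, Integrable (fun θ => η θ a) μ) (hD : Integrable D μ)
    (hopt : ∫ θ, η θ a' ∂μ ≤ ∫ θ, η θ a ∂μ)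
    (hle : ∀ θ, b + (η θ a - c) - C * D θ ≤ η θ a') :
    b ≤ c + C * ∫ θ, D θ ∂μ := by
  have h := integral_mono (((integrable_const b).add ((hη a).sub (integrable_const c))).sub
    (hD.const_mul C)) (hη a') hle
  rw [integral_sub' ((integrable_const b).add ((hη a).sub (integrable_const c)))
    (hD.const_mul C), integral_add' (integrable_const b) ((hη a).sub (integrable_const c)),
    integral_sub' (hη a) (integrable_const c), integral_const_mul] at h
  simp only [integral_const, probReal_univ, one_smul] at h
  linarith

end Expectation

/-- Potential argument: if each positive gap forces an increase of the value, gaps sum up to at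
most the total range plus the accumulated errors. -/
theorem sum_gap_le {x e : ℕ → ℝ} {m υ : ℝ} {T : ℕ} (hT : 1 ≤ T)
    (hx : ∀ t, x t ∈ Set.Icc (0 : ℝ) 1) (hm : m ≤ 1) (hυ0 : 0 ≤ υ) (hυ1 : υ ≤ 1)
    (hstep : ∀ t, 1 ≤ t → t + 1 ≤ T → υ * (m - x t) ≤ x (t + 1) - x t + e (t + 1)) :
    υ * ∑ t ∈ Finset.Icc 1 T, (m - x t) ≤ 1 + ∑ t ∈ Finset.Icc 2 T, e t := by
  have key : ∀ n, 1 ≤ n → n ≤ T → υ * ∑ t ∈ Finset.Icc 1 n, (m - x t)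
      ≤ υ * (m - x n) + x n - x 1 + ∑ t ∈ Finset.Icc 2 n, e t := by
    intro n hn
    induction n, hn using Nat.le_induction with
    | base => simp
    | succ n hn ih =>
      intro hnT
      have h₁ := ih (by omega)
      have h₂ := hstep n hn hnT
      rw [Finset.sum_Icc_succ_top (by omega), Finset.sum_Icc_succ_top (by omega)]
      linarith
  have h := key T hT le_rfl
  have h₁ := hx 1
  have hT' := hx T
  nlinarith [h₁.1, hT'.1, hT'.2]

/-- **Local regret bound for ViOlin (deterministic path of Theorem 3.1 / `thm:bandit-main`).**
The `(ε, 6√(ζ₃ε))`-local regret of a sequence of greedy virtual-reward maximizers is bounded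
by `(1/υ)(1 + C₁ ∑_{t=2}^T Δ̄_t)` with `υ = min(ε²/(4ζ_h), ε^{3/2}/√ζ₃)` and
`C₁ = 2 + ζ_g/ζ_h`. -/
theorem violin_local_regret
    {d : ℕ} (hd : 1 ≤ d)
    {Θ : Type*} [MeasurableSpace Θ] (θstar : Θ)
    (η : Θ → EuclideanSpace ℝ (Fin d) → ℝ)
    (hrange : ∀ θ a, η θ a ∈ Set.Icc (0 : ℝ) 1)
    (ζg ζh ζ3 : ℝ) (hζg : 0 < ζg) (hζh : 0 < ζh) (hζ3 : 0 < ζ3)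
    (hC2 : ∀ θ, ContDiff ℝ 2 (η θ))
    (hgradbound : ∀ θ a, ‖gradient (η θ) a‖ ≤ ζg)
    (hhessbound : ∀ θ a, ‖hessian (η θ) a‖ ≤ ζh)
    (hhesslip : ∀ θ a₁ a₂, ‖hessian (η θ) a₁ - hessian (η θ) a₂‖ ≤ ζ3 * ‖a₁ - a₂‖)
    (hmeas₀ : ∀ a, Measurable fun θ => η θ a)
    (hmeas₁ : ∀ a, Measurable fun θ => gradient (η θ) a)
    (hmeas₂ : ∀ a, Measurable fun θ => hessian (η θ) a)
    (ε : ℝ) (hε0 : 0 < ε) (hε : ε ≤ min 1 (ζ3 / 16))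
    -- the set of `(ε, 6√(ζ₃ε))`-approximate local maxima of `η(θ⋆, ·)`, assumed nonempty:
    (𝔄 : Set (EuclideanSpace ℝ (Fin d)))
    (h𝔄 : 𝔄 = {a | ‖gradient (η θstar) a‖ ≤ ε ∧
      ∀ v : EuclideanSpace ℝ (Fin d), ‖v‖ = 1 →
        ⟪hessian (η θstar) a v, v⟫ ≤ 6 * Real.sqrt (ζ3 * ε)})
    (h𝔄ne : 𝔄.Nonempty)
    (T : ℕ) (hT : 1 ≤ T)
    (p : ℕ → Measure Θ) (hp : ∀ t, IsProbabilityMeasure (p t))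
    (a : ℕ → EuclideanSpace ℝ (Fin d))
    -- for each `t ∈ {1, …, T}`, the action `a t` maximizes the expected virtual reward:
    (hopt : ∀ t ∈ Finset.Icc 1 T, ∀ a' : EuclideanSpace ℝ (Fin d),
      ∫ θ, η θ a' ∂(p t) ≤ ∫ θ, η θ (a t) ∂(p t))
    -- the instantaneous local regret:
    (δ : ℕ → ℝ)
    (hδ : ∀ t, δ t = sInf (η θstar '' 𝔄) - η θstar (a t))
    -- the expected model-error terms:
    (Δbar : ℕ → ℝ)
    (hΔbar : ∀ t, Δbar t = ∫ θ, Real.sqrt (|η θ (a t) - η θstar (a t)| ^ 2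
      + |η θ (a (t - 1)) - η θstar (a (t - 1))| ^ 2
      + ‖gradient (η θ) (a (t - 1)) - gradient (η θstar) (a (t - 1))‖ ^ 2
      + ‖hessian (η θ) (a (t - 1)) - hessian (η θstar) (a (t - 1))‖ ^ 2) ∂(p t)) :
    ∑ t ∈ Finset.Icc 1 T, δ t ≤
      (1 / min (ε ^ 2 / (4 * ζh)) (ε ^ ((3 : ℝ) / 2) / Real.sqrt ζ3)) *
        (1 + (2 + ζg / ζh) * ∑ t ∈ Finset.Icc 2 T, Δbar t) := by
  subst h𝔄
  have hε1 : ε ≤ 1 := hε.trans (min_le_left _ _)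
  have hε2 : ε ≤ ζ3 / 16 := hε.trans (min_le_right _ _)
  set r := Real.sqrt (ε / ζ3) with hr
  have hr0 : 0 < r := Real.sqrt_pos.2 (div_pos hε0 hζ3)
  have hrsq : ζ3 * r ^ 2 = ε := by
    rw [hr, Real.sq_sqrt (div_pos hε0 hζ3).le]
    field_simp
  have hr4 : r ≤ 1 / 4 := by
    rw [hr, Real.sqrt_le_left (by norm_num), div_le_iff₀ hζ3]
    linarith
  have hsqrt : Real.sqrt (ζ3 * ε) = ζ3 * r := by
    rw [← hrsq, Real.sqrt_eq_iff_mul_self_eq (by positivity) (by positivity)]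
    ring
  have hpow : ε ^ ((3 : ℝ) / 2) / Real.sqrt ζ3 = ε * r := by
    rw [hr, Real.sqrt_div hε0.le, show (3 : ℝ) / 2 = 1 + 1 / 2 by norm_num,
      Real.rpow_add hε0, Real.rpow_one, ← Real.sqrt_eq_rpow, mul_div_assoc]
  rw [hpow]
  set υ := min (ε ^ 2 / (4 * ζh)) (ε * r) with hυ
  have hυ0 : 0 < υ := lt_min (by positivity) (by positivity)
  have hυg : υ ≤ ε ^ 2 / (4 * ζh) := min_le_left _ _
  have hυh : υ ≤ ε * r := min_le_right _ _
  have hυ1 : υ ≤ 1 := by nlinarith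
  set m := sInf (η θstar '' _) with hm
  have hmle : ∀ b ∈ {a | ‖gradient (η θstar) a‖ ≤ ε ∧
      ∀ v : EuclideanSpace ℝ (Fin d), ‖v‖ = 1 →
        ⟪hessian (η θstar) a v, v⟫ ≤ 6 * Real.sqrt (ζ3 * ε)}, m ≤ η θstar b := fun b hb =>
    csInf_le ⟨0, by rintro _ ⟨c, -, rfl⟩; exact (hrange θstar c).1⟩ ⟨b, hb, rfl⟩
  have hm1 : m ≤ 1 := by
    obtain ⟨b, hb⟩ := h𝔄ne
    exact (hmle b hb).trans (hrange θstar b).2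
  have hC : 0 ≤ ζg / ζh := by positivity
  have hstep : ∀ t, 1 ≤ t → t + 1 ≤ T →
      υ * (m - η θstar (a t))
        ≤ η θstar (a (t + 1)) - η θstar (a t) + (2 + ζg / ζh) * Δbar (t + 1) := by
    intro t ht htT
    have := hp (t + 1)
    have transfer : ∀ (a' : EuclideanSpace ℝ (Fin d)) (γ : ℝ),
        (∀ θ, η θstar (a t) + γ + (η θ (a (t + 1)) - η θstar (a (t + 1)))
          - (2 + ζg / ζh) * modelError (η θ) (η θstar) (a (t + 1)) (a t) ≤ η θ a') →
        γ ≤ η θstar (a (t + 1)) - η θstar (a t) + (2 + ζg / ζh) * Δbar (t + 1) := by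
      intro a' γ h
      have h' := le_value_at_maximizer
        (integrable_of_mem_unitInterval hrange hmeas₀ (p (t + 1)))
        (integrable_modelError hrange hgradbound hhessbound hmeas₀ hmeas₁ hmeas₂ θstar
          (p (t + 1)) (a (t + 1)) (a t))
        (hopt (t + 1) (Finset.mem_Icc.2 ⟨by omega, htT⟩) a') h
      have hΔ : Δbar (t + 1)
          = ∫ θ, modelError (η θ) (η θstar) (a (t + 1)) (a t) ∂(p (t + 1)) := hΔbar (t + 1)
      rw [hΔ]
      linarith
    rcases le_or_gt (m - η θstar (a t)) 0 with hgap | hgap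
    · refine (mul_nonpos_of_nonneg_of_nonpos hυ0.le hgap).trans (transfer (a t) 0 fun θ => ?_)
      have h₁ := value_errors_add_gradient_error_le (f := η θ) (g := η θstar) (x := a t)
        (y := a (t + 1)) le_rfl |>.trans
        (mul_le_mul_of_nonneg_right (add_le_add_right hC 2) modelError_nonneg)
      have h₂ := le_abs_self (η θ (a (t + 1)) - η θstar (a (t + 1)))
      have h₃ := neg_abs_le (η θ (a t) - η θstar (a t))
      linarith
    · have hυgap : υ * (m - η θstar (a t)) ≤ υ :=
        mul_le_of_le_one_right hυ0.le (by linarith [(hrange θstar (a t)).1])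
      refine hυgap.trans ?_
      by_cases hg : ‖gradient (η θstar) (a t)‖ ≤ ε
      · obtain ⟨w, hw, hHw⟩ : ∃ w : EuclideanSpace ℝ (Fin d), ‖w‖ = 1 ∧
            6 * (ζ3 * r) < ⟪hessian (η θstar) (a t) w, w⟫ := by
          by_contra! hcon
          have := hmle (a t) ⟨hg, fun v hv => by rw [hsqrt]; exact hcon v hv⟩
          linarith
        obtain ⟨v, hv, hHv, hgv⟩ : ∃ v : EuclideanSpace ℝ (Fin d), ‖v‖ = 1 ∧
            6 * (ζ3 * r) < ⟪hessian (η θstar) (a t) v, v⟫ ∧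
            0 ≤ ⟪gradient (η θstar) (a t), v⟫ := by
          rcases le_total 0 ⟪gradient (η θstar) (a t), w⟫ with h | h
          · exact ⟨w, hw, hHw, h⟩
          · exact ⟨-w, by rwa [norm_neg], by simpa using hHw, by simpa using h⟩
        refine transfer (a t + r • v) υ fun θ => ?_
        have h := curvature_step_le (y := a (t + 1)) (hC2 θ) hζ3.le (hhesslip θ) hv hgv
          hr0.le hr4
        have hcurv : 6 * (ε * r) ≤ ⟪hessian (η θstar) (a t) v, v⟫ * r ^ 2 := by
          rw [show 6 * (ε * r) = 6 * (ζ3 * r) * r ^ 2 by rw [← hrsq]; ring]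
          gcongr
        have hcube : ζ3 * r ^ 3 = ε * r := by rw [← hrsq]; ring
        have hεr : 0 < ε * r := by positivity
        have hE := mul_nonneg hC (modelError_nonneg (f := η θ) (g := η θstar)
          (y := a (t + 1)) (x := a t))
        linarith
      · refine transfer (a t + (1 / ζh) • gradient (η θstar) (a t)) υ fun θ => ?_
        have h := gradient_step_le (y := a (t + 1)) (hC2 θ) hζg.le hζh (hhessbound θ)
          (hgradbound θstar (a t))
        have hgain : υ ≤ ‖gradient (η θstar) (a t)‖ ^ 2 / (2 * ζh) := by
          refine hυg.trans ?_
          gcongr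
          · exact (not_le.1 hg).le
          · norm_num
        linarith
  have h := sum_gap_le (e := fun t => (2 + ζg / ζh) * Δbar t) hT
    (fun t => hrange θstar (a t)) hm1 hυ0.le hυ1 hstep
  rw [← Finset.mul_sum] at h
  simp only [hδ]
  rw [one_div_mul_eq_div, le_div_iff₀ hυ0, mul_comm]
  exact h
end

section
/- Let d ≥ 1, ε > 0, and let B = { a ∈ ℝ^d : ‖a‖₂ ≤ 1 } be the closed unit ball. Let Θ be a finite set of unit vectors in ℝ^d such that ‖θ − θ'‖₂ ≥ 2·√(2ε) for all distinct θ, θ' ∈ Θ, and let T be a natural number with T < |Θ|. Let a deterministic bandit algorithm be given by a family of functions A_t : ℝ^{t−1} → B for t = 1, …, T (the action at time t as a function of the previously observed rewards). Then there exists θ⋆ ∈ Θ such that the sequences defined recursively by a_t = A_t(r₁, …, r_{t−1}) and r_t = max( ⟨θ⋆, a_t⟩ − 1 + ε, 0 ) satisfy r_t = 0 for every t ∈ {1,…,T}; consequently, since sup_{a ∈ B} max( ⟨θ⋆, a⟩ − 1 + ε, 0 ) = ε, the cumulative regret of the algorithm on the instance θ⋆ equals ∑_{t=1}^{T} ( ε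 − r_t ) = ε·T. -/
open RealInnerProductSpace

/-- A vector of the unit ball within inner product `1 - ε` of a unit vector is at distance
less than `√(2ε)` from it. -/
theorem norm_sub_lt_sqrt_of_inner_gt {E : Type*} [NormedAddCommGroup E] [InnerProductSpace ℝ E]
    {ε : ℝ} {θ b : E} (hθ : ‖θ‖ = 1) (hb : ‖b‖ ≤ 1) (h : 1 - ε < ⟪θ, b⟫) :
    ‖θ - b‖ < Real.sqrt (2 * ε) := by
  apply Real.lt_sqrt_of_sq_lt
  rw [norm_sub_sq_real, hθ]
  nlinarith [norm_nonneg b]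

/-- If fewer than `Θ.card` points of the unit ball are given, some member of a `2√(2ε)`-packing
`Θ` of unit vectors has inner product at most `1 - ε` with all of them. -/
theorem exists_mem_packing_inner_le {E : Type*} [NormedAddCommGroup E] [InnerProductSpace ℝ E]
    {ε : ℝ} {Θ : Finset E} (hunit : ∀ θ ∈ Θ, ‖θ‖ = 1)
    (hpack : ∀ θ ∈ Θ, ∀ θ' ∈ Θ, θ ≠ θ' → 2 * Real.sqrt (2 * ε) ≤ ‖θ - θ'‖)
    {T : ℕ} (hT : T < Θ.card) (b : ℕ → E) (hb : ∀ t, ‖b t‖ ≤ 1) :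
    ∃ θ ∈ Θ, ∀ t < T, ⟪θ, b t⟫ ≤ 1 - ε := by
  classical
  by_contra! hcon
  have hsub : Θ ⊆ (Finset.range T).biUnion fun t => {θ ∈ Θ | 1 - ε < ⟪θ, b t⟫} := by
    intro θ hθ
    obtain ⟨t, ht, hlt⟩ := hcon θ hθ
    simp only [Finset.mem_biUnion, Finset.mem_range, Finset.mem_filter]
    exact ⟨t, ht, hθ, hlt⟩
  have hcard := (Finset.card_le_card hsub).trans
    (Finset.card_biUnion_le_card_mul _ _ 1 fun t _ => Finset.card_le_one.2 ?_)
  · simp only [Finset.card_range, mul_one] at hcard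
    omega
  · intro θ hθ θ' hθ'
    rw [Finset.mem_filter] at hθ hθ'
    by_contra hne
    have h₁ := norm_sub_lt_sqrt_of_inner_gt (hunit θ hθ.1) (hb t) hθ.2
    have h₂ := norm_sub_lt_sqrt_of_inner_gt (hunit θ' hθ'.1) (hb t) hθ'.2
    have h₃ := norm_sub_le_norm_sub_add_norm_sub θ (b t) θ'
    rw [norm_sub_rev (b t)] at h₃
    linarith [hpack θ hθ.1 θ' hθ'.1 hne]

/-- **Exponential lower bound for one-layer ReLU bandits (core of Theorem 5.1 /
`thm:lowerbound-sample-comp`).**  For any deterministic algorithm and any `2√(2ε)`-packing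
`Θ` of unit vectors with more than `T` elements, there is an instance `θ⋆ ∈ Θ` on which the
algorithm receives reward `0` at every step, hence suffers cumulative regret exactly `ε·T`
against the reward `a ↦ max(⟨θ⋆, a⟩ - 1 + ε, 0)`. -/
theorem relu_bandit_lower_bound
    {d : ℕ} (hd : 1 ≤ d) (ε : ℝ) (hε : 0 < ε)
    (Θ : Finset (EuclideanSpace ℝ (Fin d)))
    (hunit : ∀ θ ∈ Θ, ‖θ‖ = 1)
    (hpack : ∀ θ ∈ Θ, ∀ θ' ∈ Θ, θ ≠ θ' → 2 * Real.sqrt (2 * ε) ≤ ‖θ - θ'‖)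
    (T : ℕ) (hT : T < Θ.card)
    -- a deterministic algorithm: the action at time `t` as a function of the `t`
    -- previously observed rewards, always taking values in the unit ball:
    (A : (t : ℕ) → (Fin t → ℝ) → EuclideanSpace ℝ (Fin d))
    (hA : ∀ t h, ‖A t h‖ ≤ 1) :
    ∃ θstar ∈ Θ, ∀ (a : ℕ → EuclideanSpace ℝ (Fin d)) (r : ℕ → ℝ),
      (∀ t, a t = A t fun i : Fin t => r i) →
      (∀ t, r t = max (⟪θstar, a t⟫ - 1 + ε) 0) →
      (∀ t < T, r t = 0) ∧ ∑ t ∈ Finset.range T, (ε - r t) = ε * T := by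
  obtain ⟨θ, hθ, hle⟩ :=
    exists_mem_packing_inner_le hunit hpack hT (fun t => A t fun _ => 0) fun t => hA t _
  refine ⟨θ, hθ, fun a r ha hr => ?_⟩
  have hzero : ∀ t < T, r t = 0 := by
    intro t
    induction t using Nat.strong_induction_on with
    | _ t ih =>
      intro ht
      have hhist : (fun i : Fin t => r i) = fun _ => 0 :=
        funext fun i => ih i i.2 (i.2.trans ht)
      rw [hr, ha, hhist]
      exact max_eq_right (by linarith [hle t ht])
  refine ⟨hzero, ?_⟩
  rw [Finset.sum_congr rfl fun t ht => by rw [hzero t (Finset.mem_range.1 ht), sub_zero]]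
  simp [mul_comm]
end

section
/- Let d ≥ 1, ε > 0, n ≥ 2, and let θ₁, …, θ_n ∈ ℝ^d be unit vectors such that ⟨θ_i, θ_j⟩ ≤ 1 − ε for all i ≠ j. For each i define f_i : ℝ^d → ℝ by f_i(a) = max( ⟨θ_i, a⟩ − 1 + ε, 0 ). Then for every i ∈ {1, …, n−1}: (a) f_i(θ_j) = f_{i+1}(θ_j) = 0 for every j < i, while (b) f_i(θ_i) = ε and f_{i+1}(θ_i) = 0, so |f_i(θ_i) − f_{i+1}(θ_i)| = ε. -/
open RealInnerProductSpace

/-- **Eluder-dimension witness construction for one-layer ReLU networks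
(Theorem 5.2 / `thm:lowerbound-eluder`).**  For an `ε`-separated family of unit vectors
`θ₁, …, θ_n` (0-indexed here), writing `f i a = max(⟨θ i, a⟩ - 1 + ε, 0)`, each `θ i` is
`(ε/2)`-independent of its predecessors: `f i` and `f (i+1)` agree (and vanish) on all
earlier `θ j`, while they differ by exactly `ε` at `θ i`. -/
theorem relu_eluder_witness
    {d n : ℕ} (hd : 1 ≤ d) (hn : 2 ≤ n) (ε : ℝ) (hε : 0 < ε)
    (θ : Fin n → EuclideanSpace ℝ (Fin d))
    (hunit : ∀ i, ‖θ i‖ = 1)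
    (hsep : ∀ i j, i ≠ j → ⟪θ i, θ j⟫ ≤ 1 - ε)
    (f : Fin n → EuclideanSpace ℝ (Fin d) → ℝ)
    (hf : ∀ i a, f i a = max (⟪θ i, a⟫ - 1 + ε) 0) :
    ∀ (i : ℕ) (hi : i + 1 < n),
      (∀ j : Fin n, (j : ℕ) < i →
        f ⟨i, by omega⟩ (θ j) = 0 ∧ f ⟨i + 1, hi⟩ (θ j) = 0) ∧
      f ⟨i, by omega⟩ (θ ⟨i, by omega⟩) = ε ∧
      f ⟨i + 1, hi⟩ (θ ⟨i, by omega⟩) = 0 ∧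
      |f ⟨i, by omega⟩ (θ ⟨i, by omega⟩) - f ⟨i + 1, hi⟩ (θ ⟨i, by omega⟩)| = ε := by
  have off : ∀ k l : Fin n, k ≠ l → f k (θ l) = 0 := fun k l hkl => by
    rw [hf, max_eq_right]
    linarith [hsep k l hkl]
  have diag : ∀ k : Fin n, f k (θ k) = ε := fun k => by
    rw [hf, real_inner_self_eq_norm_sq, hunit, max_eq_left] <;> linarith
  intro i hi
  have hnext : f ⟨i + 1, hi⟩ (θ ⟨i, by omega⟩) = 0 := off _ _ (by simp)
  refine ⟨fun j hj => ⟨off _ _ ?_, off _ _ ?_⟩, diag _, hnext, ?_⟩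
  · rintro rfl
    exact lt_irrefl _ hj
  · rintro rfl
    exact absurd hj (by simp)
  · rw [diag, hnext, sub_zero, abs_of_pos hε]
end

section
/- Let d ≥ 1, let H be a real symmetric d×d matrix, and let u, v be independent standard Gaussian random vectors in ℝ^d (i.e. the pair (u,v) has law equal to the product of two copies of the d-fold product of N(0,1)). Then P[ (uᵀ H v)² ≥ ‖H‖_F² / 8 ] ≥ 1/64, where ‖H‖_F = √(∑_{i,j} H_{ij}²) is the Frobenius norm. -/
open MeasureTheory ProbabilityTheory Matrix

/-- A linear form of a standard Gaussian vector is Gaussian, with variance the squared Euclidean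
norm of the coefficients. -/
theorem map_dotProduct_pi_gaussianReal {ι : Type*} [Fintype ι] (w : ι → ℝ) :
    (Measure.pi fun _ : ι => gaussianReal 0 1).map (fun x => w ⬝ᵥ x) =
      gaussianReal 0 (∑ i, w i ^ 2).toNNReal := by
  have hm : Measurable fun x : ι → ℝ => w ⬝ᵥ x := by
    unfold dotProduct; fun_prop
  have : IsProbabilityMeasure
      ((Measure.pi fun _ : ι => gaussianReal 0 1).map (fun x => w ⬝ᵥ x)) :=
    Measure.isProbabilityMeasure_map hm.aemeasurable
  refine Measure.ext_of_charFun ?_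
  ext t
  rw [charFun_apply_real, integral_map hm.aemeasurable (by fun_prop), charFun_gaussianReal]
  have h1 (x : ι → ℝ) : Complex.exp (t * (w ⬝ᵥ x : ℝ) * Complex.I) =
      ∏ i, Complex.exp (((t * w i : ℝ) : ℂ) * (x i : ℝ) * Complex.I) := by
    rw [← Complex.exp_sum]
    congr 1
    simp only [dotProduct, Complex.ofReal_sum, Complex.ofReal_mul, Finset.mul_sum, Finset.sum_mul]
    exact Finset.sum_congr rfl fun i _ => by ring
  simp_rw [h1]
  rw [integral_fintype_prod_eq_prod
    (f := fun i (y : ℝ) => Complex.exp (((t * w i : ℝ) : ℂ) * y * Complex.I))]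
  simp_rw [← charFun_apply_real, charFun_gaussianReal]
  rw [← Complex.exp_sum]
  congr 1
  rw [Real.coe_toNNReal _ (by positivity)]
  push_cast
  simp only [Finset.sum_mul, Finset.sum_div, mul_zero, zero_mul, zero_sub, ← Finset.sum_neg_distrib]
  exact Finset.sum_congr rfl fun i _ => by ring

theorem integral_pow_two_gaussianReal (v : NNReal) :
    ∫ x, x ^ 2 ∂gaussianReal 0 v = v := by
  rw [← variance_fun_id_gaussianReal (μ := 0) (v := v),
    variance_of_integral_eq_zero (by fun_prop) (by simp)]

theorem integral_pow_four_gaussianReal (v : NNReal) :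
    ∫ x, x ^ 4 ∂gaussianReal 0 v = 3 * (v : ℝ) ^ 2 := by
  have h := iteratedDeriv_mgf_zero (X := id) (μ := gaussianReal 0 v) (by simp) 4
  have hE (t : ℝ) : HasDerivAt (fun t : ℝ => Real.exp (v * t ^ 2 / 2))
      (Real.exp (v * t ^ 2 / 2) * (v * t)) t := by
    refine (((hasDerivAt_pow 2 t).const_mul (v : ℝ)).div_const 2).exp.congr_deriv ?_
    norm_num
    ring
  have h0 : mgf id (gaussianReal 0 v) = fun t => Real.exp (v * t ^ 2 / 2) := by
    rw [mgf_id_gaussianReal]; ext t; simp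
  have h1 : deriv (mgf id (gaussianReal 0 v)) = fun t => Real.exp (v * t ^ 2 / 2) * (v * t) := by
    rw [h0]; ext t; exact (hE t).deriv
  have h2 : deriv (deriv (mgf id (gaussianReal 0 v))) =
      fun t => Real.exp (v * t ^ 2 / 2) * (v + v ^ 2 * t ^ 2) := by
    rw [h1]; ext t
    refine (((hE t).mul ((hasDerivAt_id t).const_mul (v : ℝ))).congr_deriv ?_).deriv
    simp only [id]
    ring
  have h3 : deriv (deriv (deriv (mgf id (gaussianReal 0 v)))) =
      fun t => Real.exp (v * t ^ 2 / 2) * (3 * v ^ 2 * t + v ^ 3 * t ^ 3) := by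
    rw [h2]; ext t
    refine (((hE t).mul
      (((hasDerivAt_pow 2 t).const_mul ((v : ℝ) ^ 2)).const_add (v : ℝ))).congr_deriv ?_).deriv
    norm_num
    ring
  have h4 : deriv (deriv (deriv (deriv (mgf id (gaussianReal 0 v))))) 0 = 3 * (v : ℝ) ^ 2 := by
    rw [h3]
    refine (((hE 0).mul (((hasDerivAt_id (0 : ℝ)).const_mul (3 * (v : ℝ) ^ 2)).add
      ((hasDerivAt_pow 3 (0 : ℝ)).const_mul ((v : ℝ) ^ 3)))).congr_deriv ?_).deriv
    simp
  simp only [iteratedDeriv_succ, iteratedDeriv_zero, h4] at h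
  simpa using h.symm

theorem integrable_pow_gaussianReal (v : NNReal) (n : ℕ) :
    Integrable (fun x => x ^ n) (gaussianReal 0 v) := by
  simpa using integrable_pow_of_mem_interior_integrableExpSet (X := id) (μ := gaussianReal 0 v)
    (by simp) n

section DotProduct

variable {ι : Type*} [Fintype ι] (w : ι → ℝ)

theorem measurable_dotProduct_left : Measurable fun x : ι → ℝ => w ⬝ᵥ x := by
  unfold dotProduct; fun_prop

theorem integrable_dotProduct_pow_pi_gaussianReal (n : ℕ) :
    Integrable (fun x => (w ⬝ᵥ x) ^ n) (Measure.pi fun _ : ι => gaussianReal 0 1) := by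
  have h := integrable_pow_gaussianReal (∑ i, w i ^ 2).toNNReal n
  rw [← map_dotProduct_pi_gaussianReal] at h
  exact h.comp_measurable (measurable_dotProduct_left w)

theorem integral_dotProduct_pow_two_pi_gaussianReal :
    ∫ x, (w ⬝ᵥ x) ^ 2 ∂(Measure.pi fun _ : ι => gaussianReal 0 1) = ∑ i, w i ^ 2 := by
  have h := integral_pow_two_gaussianReal (∑ i, w i ^ 2).toNNReal
  rwa [← map_dotProduct_pi_gaussianReal, Real.coe_toNNReal _ (by positivity),
    integral_map (measurable_dotProduct_left w).aemeasurable (by fun_prop)] at h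

theorem integral_dotProduct_pow_four_pi_gaussianReal :
    ∫ x, (w ⬝ᵥ x) ^ 4 ∂(Measure.pi fun _ : ι => gaussianReal 0 1) = 3 * (∑ i, w i ^ 2) ^ 2 := by
  have h := integral_pow_four_gaussianReal (∑ i, w i ^ 2).toNNReal
  rwa [← map_dotProduct_pi_gaussianReal, Real.coe_toNNReal _ (by positivity),
    integral_map (measurable_dotProduct_left w).aemeasurable (by fun_prop)] at h

end DotProduct

theorem vecMul_apply_eq_dotProduct {m n : Type*} [Fintype m] (H : Matrix m n ℝ) (x : m → ℝ)
    (j : n) : (x ᵥ* H) j = (fun i => H i j) ⬝ᵥ x := by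
  simp [vecMul, dotProduct, mul_comm]

theorem integrable_vecMul_pow_pi_gaussianReal {m n : Type*} [Fintype m]
    (H : Matrix m n ℝ) (j : n) (k : ℕ) :
    Integrable (fun x => (x ᵥ* H) j ^ k) (Measure.pi fun _ : m => gaussianReal 0 1) := by
  simp_rw [vecMul_apply_eq_dotProduct]
  exact integrable_dotProduct_pow_pi_gaussianReal _ k

section Bilinear

variable {m n : Type*} [Fintype m] [Fintype n] (H : Matrix m n ℝ)

/-- Cauchy–Schwarz with the squared column norms as weights. -/
theorem sq_sum_vecMul_sq_le (x : m → ℝ) :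
    (∑ j, (x ᵥ* H) j ^ 2) ^ 2 ≤
      (∑ j, ∑ i, H i j ^ 2) * ∑ j, (x ᵥ* H) j ^ 4 / ∑ i, H i j ^ 2 := by
  refine Finset.sum_sq_le_sum_mul_sum_of_sq_le_mul _ (fun j _ => by positivity)
    (fun j _ => by positivity) fun j _ => le_of_eq ?_
  by_cases h : ∑ i, H i j ^ 2 = 0
  · have h0 : ∀ i, H i j = 0 := by
      simpa [Finset.sum_eq_zero_iff_of_nonneg, sq_nonneg] using h
    simp [vecMul, dotProduct, h0]
  · field_simp

theorem integrable_sum_vecMul_sq :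
    Integrable (fun x => ∑ j, (x ᵥ* H) j ^ 2) (Measure.pi fun _ : m => gaussianReal 0 1) :=
  integrable_finsetSum _ fun j _ => integrable_vecMul_pow_pi_gaussianReal H j 2

theorem integral_sum_vecMul_sq :
    ∫ x, ∑ j, (x ᵥ* H) j ^ 2 ∂(Measure.pi fun _ : m => gaussianReal 0 1) =
      ∑ i, ∑ j, H i j ^ 2 := by
  rw [integral_finsetSum _ fun j _ => integrable_vecMul_pow_pi_gaussianReal H j 2,
    Finset.sum_comm]
  simp_rw [vecMul_apply_eq_dotProduct, integral_dotProduct_pow_two_pi_gaussianReal]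

theorem integrable_sum_vecMul_pow_four_div :
    Integrable (fun x => (∑ j, ∑ i, H i j ^ 2) * ∑ j, (x ᵥ* H) j ^ 4 / ∑ i, H i j ^ 2)
      (Measure.pi fun _ : m => gaussianReal 0 1) :=
  (integrable_finsetSum _ fun j _ =>
    (integrable_vecMul_pow_pi_gaussianReal H j 4).div_const _).const_mul _

theorem integrable_sq_sum_vecMul_sq :
    Integrable (fun x => (∑ j, (x ᵥ* H) j ^ 2) ^ 2)
      (Measure.pi fun _ : m => gaussianReal 0 1) := by
  refine (integrable_sum_vecMul_pow_four_div H).mono'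
    ((integrable_sum_vecMul_sq H).aestronglyMeasurable.pow 2) (ae_of_all _ fun x => ?_)
  rw [Real.norm_of_nonneg (by positivity)]
  exact sq_sum_vecMul_sq_le H x

theorem integral_sq_sum_vecMul_sq_le :
    ∫ x, (∑ j, (x ᵥ* H) j ^ 2) ^ 2 ∂(Measure.pi fun _ : m => gaussianReal 0 1) ≤
      3 * (∑ i, ∑ j, H i j ^ 2) ^ 2 := by
  refine (integral_mono (integrable_sq_sum_vecMul_sq H) (integrable_sum_vecMul_pow_four_div H)
    (sq_sum_vecMul_sq_le H)).trans_eq ?_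
  rw [integral_const_mul, integral_finsetSum _ fun j _ =>
    (integrable_vecMul_pow_pi_gaussianReal H j 4).div_const _]
  simp_rw [integral_div, vecMul_apply_eq_dotProduct, integral_dotProduct_pow_four_pi_gaussianReal]
  have h (j : n) : 3 * (∑ i, H i j ^ 2) ^ 2 / ∑ i, H i j ^ 2 = 3 * ∑ i, H i j ^ 2 := by
    by_cases h : ∑ i, H i j ^ 2 = 0
    · simp [h]
    · field_simp
  simp_rw [h, ← Finset.mul_sum]
  rw [Finset.sum_comm]
  ring

theorem measurable_dotProduct_mulVec :
    Measurable fun p : (m → ℝ) × (n → ℝ) => p.1 ⬝ᵥ H *ᵥ p.2 := by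
  unfold mulVec dotProduct; fun_prop

theorem integrable_dotProduct_mulVec_pow_four :
    Integrable (fun p : (m → ℝ) × (n → ℝ) => (p.1 ⬝ᵥ H *ᵥ p.2) ^ 4)
      ((Measure.pi fun _ : m => gaussianReal 0 1).prod
        (Measure.pi fun _ : n => gaussianReal 0 1)) := by
  rw [integrable_prod_iff ((measurable_dotProduct_mulVec H).pow_const 4).aestronglyMeasurable]
  simp_rw [dotProduct_mulVec, Real.norm_of_nonneg (Even.pow_nonneg (by decide : Even 4) _),
    integral_dotProduct_pow_four_pi_gaussianReal]
  exact ⟨ae_of_all _ fun x => integrable_dotProduct_pow_pi_gaussianReal _ 4,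
    (integrable_sq_sum_vecMul_sq H).const_mul 3⟩

theorem integrable_dotProduct_mulVec_sq :
    Integrable (fun p : (m → ℝ) × (n → ℝ) => (p.1 ⬝ᵥ H *ᵥ p.2) ^ 2)
      ((Measure.pi fun _ : m => gaussianReal 0 1).prod
        (Measure.pi fun _ : n => gaussianReal 0 1)) := by
  rw [integrable_prod_iff ((measurable_dotProduct_mulVec H).pow_const 2).aestronglyMeasurable]
  simp_rw [dotProduct_mulVec, Real.norm_of_nonneg (sq_nonneg _),
    integral_dotProduct_pow_two_pi_gaussianReal]
  exact ⟨ae_of_all _ fun x => integrable_dotProduct_pow_pi_gaussianReal _ 2,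
    integrable_sum_vecMul_sq H⟩

theorem integral_dotProduct_mulVec_sq :
    ∫ p, (p.1 ⬝ᵥ H *ᵥ p.2) ^ 2 ∂((Measure.pi fun _ : m => gaussianReal 0 1).prod
      (Measure.pi fun _ : n => gaussianReal 0 1)) = ∑ i, ∑ j, H i j ^ 2 := by
  rw [integral_prod _ (integrable_dotProduct_mulVec_sq H)]
  simp_rw [dotProduct_mulVec, integral_dotProduct_pow_two_pi_gaussianReal]
  exact integral_sum_vecMul_sq H

theorem integral_dotProduct_mulVec_pow_four_le :
    ∫ p, (p.1 ⬝ᵥ H *ᵥ p.2) ^ 4 ∂((Measure.pi fun _ : m => gaussianReal 0 1).prod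
      (Measure.pi fun _ : n => gaussianReal 0 1)) ≤ 9 * (∑ i, ∑ j, H i j ^ 2) ^ 2 := by
  rw [integral_prod _ (integrable_dotProduct_mulVec_pow_four H)]
  simp_rw [dotProduct_mulVec, integral_dotProduct_pow_four_pi_gaussianReal]
  rw [integral_const_mul]
  linarith [integral_sq_sum_vecMul_sq_le H]

end Bilinear

/-- A Paley–Zygmund type bound: a random variable whose square has mean `M` and whose fourth moment
is at most `9 * M ^ 2` satisfies `X ^ 2 ≥ M / 8` with probability at least `1 / 64`. -/
theorem measure_div_eight_le_sq_ge {Ω : Type*} [MeasurableSpace Ω] {P : Measure Ω}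
    [IsProbabilityMeasure P] {X : Ω → ℝ} (hX : Measurable X) {M : ℝ}
    (h2 : Integrable (fun ω => X ω ^ 2) P) (h4 : Integrable (fun ω => X ω ^ 4) P)
    (hM2 : ∫ ω, X ω ^ 2 ∂P = M) (hM4 : ∫ ω, X ω ^ 4 ∂P ≤ 9 * M ^ 2) :
    ENNReal.ofReal (1 / 64) ≤ P {ω | M / 8 ≤ X ω ^ 2} := by
  have hM : 0 ≤ M := hM2 ▸ integral_nonneg fun ω => sq_nonneg _
  have hs : MeasurableSet {ω | M / 8 ≤ X ω ^ 2} :=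
    measurableSet_le measurable_const (hX.pow_const 2)
  rcases hM.eq_or_lt with rfl | hM
  · have : {ω | (0 : ℝ) / 8 ≤ X ω ^ 2} = Set.univ := by
      ext ω; simp [sq_nonneg]
    rw [this, measure_univ]
    exact ENNReal.ofReal_le_one.2 (by norm_num)
  rw [← ofReal_measureReal]
  refine ENNReal.ofReal_le_ofReal ?_
  rw [← integral_indicator_one hs]
  have hsub : Integrable (fun ω => 1 / 5 / M * X ω ^ 2 - 1 / 100 / M ^ 2 * X ω ^ 4) P :=
    (h2.const_mul _).sub (h4.const_mul _)
  have hle : ∫ ω, (1 / 5 / M * X ω ^ 2 - 1 / 100 / M ^ 2 * X ω ^ 4 - 1 / 40) ∂P ≤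
      ∫ ω, {ω | M / 8 ≤ X ω ^ 2}.indicator (1 : Ω → ℝ) ω ∂P := by
    refine integral_mono (hsub.sub (integrable_const _)) ((integrable_const (1 : ℝ)).indicator hs) fun ω => ?_
    obtain ⟨y, hy⟩ : ∃ y, y = X ω ^ 2 / M := ⟨_, rfl⟩
    have e : 1 / 5 / M * X ω ^ 2 - 1 / 100 / M ^ 2 * X ω ^ 4 - 1 / 40 =
        y / 5 - y ^ 2 / 100 - 1 / 40 := by
      rw [hy]; field_simp
    simp only [e]
    by_cases hω : M / 8 ≤ X ω ^ 2
    · rw [Set.indicator_of_mem (by exact hω)]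
      simp only [Pi.one_apply]
      nlinarith [sq_nonneg (y - 10)]
    · rw [Set.indicator_of_notMem (by exact hω)]
      have : y ≤ 1 / 8 := by
        rw [hy, div_le_iff₀ hM]; linarith
      nlinarith [sq_nonneg y]
  refine le_trans ?_ hle
  rw [integral_sub hsub (integrable_const _),
    integral_sub (h2.const_mul _) (h4.const_mul _), integral_const_mul, integral_const_mul, hM2]
  have h9 : 1 / 100 / M ^ 2 * ∫ ω, X ω ^ 4 ∂P ≤ 9 / 100 := by
    refine (mul_le_mul_of_nonneg_left hM4 (by positivity)).trans_eq ?_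
    field_simp
  have h1 : 1 / 5 / M * M = 1 / 5 := by field_simp
  rw [h1]
  simp only [integral_const, probReal_univ, one_smul]
  linarith

/-- **Anti-concentration of Gaussian bilinear forms (Lemma C.5 /
`lem:square-bilinear-anti-concentration`).**  For a symmetric `d × d` matrix `H` and
independent standard Gaussian vectors `u, v` in `ℝ^d`,
`P[(uᵀHv)² ≥ ‖H‖_F²/8] ≥ 1/64`. -/
theorem gaussian_bilinear_anti_concentration
    {d : ℕ} (hd : 1 ≤ d) (H : Matrix (Fin d) (Fin d) ℝ) (hH : H.IsSymm) :
    ENNReal.ofReal (1 / 64) ≤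
      ((Measure.pi fun _ : Fin d => gaussianReal 0 1).prod
          (Measure.pi fun _ : Fin d => gaussianReal 0 1))
        {p : (Fin d → ℝ) × (Fin d → ℝ) |
          (∑ i, ∑ j, H i j ^ 2) / 8 ≤ (p.1 ⬝ᵥ H.mulVec p.2) ^ 2} := by
  exact measure_div_eight_le_sq_ge (measurable_dotProduct_mulVec H)
    (integrable_dotProduct_mulVec_sq H) (integrable_dotProduct_mulVec_pow_four H)
    (integral_dotProduct_mulVec_sq H) (integral_dotProduct_mulVec_pow_four_le H)
end

section
/- Let 0 < s ≤ κ be real numbers and let X be a real random variable with the Gaussian law N(0, s²) of mean 0 and variance s². Then E[ min( κ², X² ) ] ≥ s² / 2. -/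
open MeasureTheory ProbabilityTheory

open scoped NNReal

lemma hasDerivAt_mul_gaussianPDFReal_zero {v : ℝ≥0} (hv : v ≠ 0) (x : ℝ) :
    HasDerivAt (fun y ↦ v * (y * gaussianPDFReal 0 v y))
      (gaussianPDFReal 0 v x * (v - x ^ 2)) x := by
  have hv' : (v : ℝ) ≠ 0 := by exact_mod_cast hv
  have hexp : HasDerivAt (fun y : ℝ ↦ Real.exp (-(y - 0) ^ 2 / (2 * v)))
      (Real.exp (-(x - 0) ^ 2 / (2 * v)) * (-(2 * x) / (2 * v))) x := by
    have hsq : HasDerivAt (fun y : ℝ ↦ -(y - 0) ^ 2 / (2 * v)) (-(2 * x) / (2 * v)) x := by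
      simpa using ((hasDerivAt_pow 2 x).neg.div_const (2 * (v : ℝ)))
    exact hsq.exp
  unfold gaussianPDFReal
  refine (((hasDerivAt_id x).mul (hexp.const_mul (√(2 * Real.pi * v))⁻¹)).const_mul
    (v : ℝ)).congr_deriv ?_
  simp only [id_eq]
  field_simp
  ring

lemma intervalIntegral_gaussianPDFReal_mul_sub_sq {v : ℝ≥0} (hv : v ≠ 0) (s : ℝ) :
    ∫ x in (-s)..s, gaussianPDFReal 0 v x * (v - x ^ 2) =
      2 * v * s * gaussianPDFReal 0 v s := by
  have hcont : Continuous (fun x ↦ gaussianPDFReal 0 v x * ((v : ℝ) - x ^ 2)) := by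
    unfold gaussianPDFReal
    fun_prop
  rw [intervalIntegral.integral_eq_sub_of_hasDerivAt
    (fun x _ ↦ hasDerivAt_mul_gaussianPDFReal_zero hv x) (hcont.intervalIntegrable _ _)]
  have heven : gaussianPDFReal 0 v (-s) = gaussianPDFReal 0 v s := by
    simp [gaussianPDFReal]
  rw [heven]
  ring

lemma min_sq_eq_sub_indicator {s : ℝ} (hs : 0 ≤ s) (x : ℝ) :
    min (s ^ 2) (x ^ 2) = s ^ 2 - (Set.Ioc (-s) s).indicator (fun y ↦ s ^ 2 - y ^ 2) x := by
  by_cases hx : x ∈ Set.Ioc (-s) s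
  · rw [Set.indicator_of_mem hx, min_eq_right (by nlinarith [hx.1, hx.2])]
    ring
  · rw [Set.indicator_of_notMem hx, sub_zero, min_eq_left]
    rw [Set.mem_Ioc, not_and_or, not_lt, not_le] at hx
    rcases hx with hx | hx <;> nlinarith

lemma mul_gaussianPDFReal_zero_self_le {s : ℝ} (hs : 0 < s) {v : ℝ≥0} (hv : (v : ℝ) = s ^ 2) :
    s * gaussianPDFReal 0 v s ≤ 1 / 4 := by
  have hsqrt : √(2 * Real.pi * s ^ 2) = √(2 * Real.pi) * s := by
    rw [Real.sqrt_mul (by positivity), Real.sqrt_sq hs.le]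
  have hexponent : -(s - 0) ^ 2 / (2 * s ^ 2) = -(1 / 2) := by
    field_simp
    ring
  rw [gaussianPDFReal, hv, hsqrt, hexponent, Real.exp_neg]
  have hprod : 4 ≤ √(2 * Real.pi) * Real.exp (1 / 2) := by
    refine le_of_sq_le_sq ?_ (by positivity)
    rw [mul_pow, Real.sq_sqrt (by positivity), ← Real.exp_nat_mul]
    norm_num
    nlinarith [Real.pi_gt_d2, Real.exp_one_gt_d9]
  calc s * ((√(2 * Real.pi) * s)⁻¹ * (Real.exp (1 / 2))⁻¹)
      = 1 / (√(2 * Real.pi) * Real.exp (1 / 2)) := by field_simp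
    _ ≤ 1 / 4 := one_div_le_one_div_of_le (by norm_num) hprod

lemma integrable_min_sq (c : ℝ) (μ : Measure ℝ) [IsFiniteMeasure μ] :
    Integrable (fun x ↦ min (c ^ 2) (x ^ 2)) μ := by
  refine Integrable.of_bound (C := c ^ 2) (by fun_prop) (.of_forall fun x ↦ ?_)
  rw [Real.norm_of_nonneg (by positivity)]
  exact min_le_left _ _

lemma integral_min_sq_gaussianReal {s : ℝ} (hs : 0 < s) {v : ℝ≥0} (hv : (v : ℝ) = s ^ 2) :
    ∫ x, min (s ^ 2) (x ^ 2) ∂(gaussianReal 0 v) =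
      s ^ 2 - 2 * s ^ 2 * (s * gaussianPDFReal 0 v s) := by
  have hv0 : v ≠ 0 := by
    rintro rfl
    exact (pow_pos hs 2).ne hv
  have hind : Integrable ((Set.Ioc (-s) s).indicator fun y ↦ s ^ 2 - y ^ 2)
      (gaussianReal 0 v) := by
    refine ((integrable_const (s ^ 2)).sub (integrable_min_sq s _)).congr (.of_forall fun x ↦ ?_)
    simp [min_sq_eq_sub_indicator hs.le]
  simp_rw [min_sq_eq_sub_indicator hs.le]
  rw [integral_sub (integrable_const _) hind, integral_const, probReal_univ, one_smul,
    integral_gaussianReal_eq_integral_smul hv0]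
  have hsmul : (fun x ↦ gaussianPDFReal 0 v x •
      (Set.Ioc (-s) s).indicator (fun y ↦ s ^ 2 - y ^ 2) x) =
      (Set.Ioc (-s) s).indicator fun x ↦ gaussianPDFReal 0 v x * (v - x ^ 2) := by
    ext x
    by_cases hx : x ∈ Set.Ioc (-s) s <;> simp [hx, hv]
  rw [hsmul, integral_indicator measurableSet_Ioc,
    ← intervalIntegral.integral_of_le (by linarith),
    intervalIntegral_gaussianPDFReal_mul_sub_sq hv0, hv]
  ring

/-- **Clipped Gaussian second moment.**  For `0 < s ≤ κ` and `X ~ N(0, s²)`,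
`E[min(κ², X²)] ≥ s²/2`. -/
theorem clipped_gaussian_second_moment
    (s κ : ℝ) (hs : 0 < s) (hsκ : s ≤ κ) :
    s ^ 2 / 2 ≤ ∫ x, min (κ ^ 2) (x ^ 2) ∂(gaussianReal 0 ⟨s ^ 2, sq_nonneg s⟩) := by
  set v : ℝ≥0 := ⟨s ^ 2, sq_nonneg s⟩
  have hv : (v : ℝ) = s ^ 2 := rfl
  calc s ^ 2 / 2 ≤ s ^ 2 - 2 * s ^ 2 * (s * gaussianPDFReal 0 v s) := by
        nlinarith [mul_gaussianPDFReal_zero_self_le hs hv, sq_nonneg s]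
    _ = ∫ x, min (s ^ 2) (x ^ 2) ∂(gaussianReal 0 v) := (integral_min_sq_gaussianReal hs hv).symm
    _ ≤ ∫ x, min (κ ^ 2) (x ^ 2) ∂(gaussianReal 0 v) :=
        integral_mono (integrable_min_sq s _) (integrable_min_sq κ _) fun x ↦
          min_le_min_right _ (pow_le_pow_left₀ hs.le hsκ 2)
end

section
/- Let σ > 0 and let P : ℝ → ℝ be the density of the one-dimensional Gaussian measure N(0, σ²), i.e. P(y) = (1/(σ·√(2π)))·exp(−y²/(2σ²)). Then for every real x ≥ 0, ∫_{0}^{∞} ( P(y − x) − P(y + x) ) · |y − x| dy ≤ 3x²/σ + 4x. -/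
open MeasureTheory Set in
theorem setIntegral_Ioi_comp_add_right (f : ℝ → ℝ) (a c : ℝ) :
    ∫ y in Ioi a, f (y + c) = ∫ y in Ioi (a + c), f y := by
  rw [← integral_indicator measurableSet_Ioi, ← integral_indicator measurableSet_Ioi,
    ← integral_add_right_eq_self ((Ioi (a + c)).indicator f) c]
  congr 1 with y
  simp [indicator]

open MeasureTheory Set in
/-- For a probability density `P` on `ℝ` with a finite first moment, the shift integral is at most
`3 * x`. -/
theorem setIntegral_shift_sub_mul_abs_le (P : ℝ → ℝ) (hP : ∀ y, 0 ≤ P y) (hint : Integrable P)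
    (hmom : Integrable fun y => P y * |y|) (hone : ∫ y, P y = 1) (x : ℝ) (hx : 0 ≤ x) :
    ∫ y in Ioi (0 : ℝ), (P (y - x) - P (y + x)) * |y - x| ≤ 3 * x := by
  have hI₁ : Integrable fun y => P (y - x) * |y - x| := hmom.comp_sub_right x
  have hI₂ : Integrable fun y => P (y + x) * |y + x| := hmom.comp_add_right x
  have hI₃ : Integrable fun y => 2 * x * P (y + x) := (hint.comp_add_right x).const_mul (2 * x)
  have hI₄ : Integrable fun y => (P (y - x) - P (y + x)) * |y - x| := by
    have h : Integrable fun y => P (y + x) * |y - x| := by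
      refine (hI₂.add hI₃).mono' ?_ (.of_forall fun y => ?_)
      · exact (hint.comp_add_right x).aestronglyMeasurable.mul
          (by fun_prop : Continuous fun y : ℝ => |y - x|).aestronglyMeasurable
      · have h₁ : |y - x| ≤ |y + x| + 2 * x := by
          rw [abs_le]
          constructor <;> linarith [neg_abs_le (y + x), le_abs_self (y + x)]
        rw [Real.norm_eq_abs, abs_of_nonneg (mul_nonneg (hP _) (abs_nonneg _)), Pi.add_apply]
        nlinarith [mul_le_mul_of_nonneg_left h₁ (hP (y + x))]
    simp only [sub_mul]
    exact hI₁.sub h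
  have hmono : ∫ y in Ioi (0 : ℝ), (P (y - x) - P (y + x)) * |y - x| ≤
      ∫ y in Ioi (0 : ℝ), (P (y - x) * |y - x| - P (y + x) * |y + x| + 2 * x * P (y + x)) := by
    refine setIntegral_mono_on hI₄.integrableOn ((hI₁.sub hI₂).add hI₃).integrableOn
      measurableSet_Ioi fun y hy => ?_
    have h₁ : |y + x| ≤ |y - x| + 2 * x := by
      rw [abs_of_pos (add_pos_of_pos_of_nonneg hy hx)]
      linarith [le_abs_self (y - x)]
    nlinarith [mul_le_mul_of_nonneg_left h₁ (hP (y + x))]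
  have htail : ∫ y in Ioi (0 : ℝ), P (y + x) ≤ 1 :=
    (setIntegral_le_integral (hint.comp_add_right x) (.of_forall fun y => hP _)).trans_eq
      ((integral_add_right_eq_self P x).trans hone)
  have hsub : (∫ y in Ioi (0 : ℝ), P (y - x) * |y - x|) -
      ∫ y in Ioi (0 : ℝ), P (y + x) * |y + x| ≤ x := by
    have h₁ := setIntegral_Ioi_comp_add_right (fun y => P y * |y|) 0 (-x)
    have h₂ := setIntegral_Ioi_comp_add_right (fun y => P y * |y|) 0 x
    simp only [← sub_eq_add_neg, zero_sub, zero_add] at h₁ h₂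
    have hle : -x ≤ x := by linarith
    rw [h₁, h₂, intervalIntegral.integral_Ioi_sub_Ioi hmom.integrableOn hle,
      intervalIntegral.integral_of_le hle]
    calc ∫ y in Ioc (-x) x, P y * |y|
        ≤ ∫ y in Ioc (-x) x, P y * x :=
          setIntegral_mono_on hmom.integrableOn (hint.mul_const x).integrableOn measurableSet_Ioc
            fun y hy => mul_le_mul_of_nonneg_left (abs_le.2 ⟨hy.1.le, hy.2⟩) (hP y)
      _ ≤ ∫ y, P y * x :=
          setIntegral_le_integral (hint.mul_const x) (.of_forall fun y => mul_nonneg (hP y) hx)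
      _ = x := by rw [integral_mul_const, hone, one_mul]
  have hadd := integral_add (hI₁.sub hI₂).integrableOn (hI₃.integrableOn (s := Ioi (0 : ℝ)))
  have hdiff := integral_sub (hI₁.integrableOn (s := Ioi (0 : ℝ))) hI₂.integrableOn
  simp only [Pi.sub_apply] at hadd
  rw [hadd, hdiff, integral_const_mul] at hmono
  nlinarith [mul_le_mul_of_nonneg_left htail hx]

/-- **Lemma C.14, part 2 (`lem:lip-1-1dim`).**  With `P` the density of `N(0, σ²)`,
for every `x ≥ 0`, `∫_{0}^{∞} (P(y-x) - P(y+x)) |y-x| dy ≤ 3x²/σ + 4x`. -/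
theorem gaussian_shift_integral_abs
    (σ : ℝ) (hσ : 0 < σ)
    (P : ℝ → ℝ)
    (hP : ∀ y, P y = (1 / (σ * Real.sqrt (2 * Real.pi))) * Real.exp (-y ^ 2 / (2 * σ ^ 2)))
    (x : ℝ) (hx : 0 ≤ x) :
    ∫ y in Set.Ioi (0 : ℝ), (P (y - x) - P (y + x)) * |y - x| ≤ 3 * x ^ 2 / σ + 4 * x := by
  have hv : (σ ^ 2).toNNReal ≠ 0 := by
    simpa using hσ.ne'
  have hPdf : P = ProbabilityTheory.gaussianPDFReal 0 (σ ^ 2).toNNReal := by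
    ext y
    rw [hP, ProbabilityTheory.gaussianPDFReal, Real.coe_toNNReal _ (sq_nonneg σ), sub_zero,
      Real.sqrt_mul (x := 2 * Real.pi) (by positivity), Real.sqrt_sq hσ.le, one_div, mul_comm σ]
  have hmom : MeasureTheory.Integrable fun y => P y * |y| := by
    have hb : 0 < 1 / (2 * σ ^ 2) := by positivity
    convert ((integrable_mul_exp_neg_mul_sq hb).abs.const_mul
      (1 / (σ * Real.sqrt (2 * Real.pi)))) using 2 with y
    rw [hP, abs_mul, Real.abs_exp, mul_assoc, mul_comm |y|,
      show -y ^ 2 / (2 * σ ^ 2) = -(1 / (2 * σ ^ 2)) * y ^ 2 by ring]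
  have hmain : ∫ y in Set.Ioi (0 : ℝ), (P (y - x) - P (y + x)) * |y - x| ≤ 3 * x := by
    refine setIntegral_shift_sub_mul_abs_le P ?_ ?_ hmom ?_ x hx
    · exact hPdf ▸ ProbabilityTheory.gaussianPDFReal_nonneg 0 _
    · exact hPdf ▸ ProbabilityTheory.integrable_gaussianPDFReal 0 _
    · exact hPdf ▸ ProbabilityTheory.integral_gaussianPDFReal_eq_one 0 hv
  have : 0 ≤ 3 * x ^ 2 / σ := by positivity
  linarith
end
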